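/- arXiv:1104.4412 — 3 statements merged into one kernel-verified Lean document; each statement's English description precedes it below -/
import Mathlib

section
/- There exists N such that for all n ≥ N and every p with 48²(log n)⁷/n ≤ p ≤ 1 − 36·n^{−1/2}(log n)^{7/2}, the probability that G ~ G_{n,p} is not p-pseudorandom is at most 11/log n. -/
open scoped Classical
open SimpleGraph

namespace EDHC

/-- Degree of a vertex (as cardinality of its neighbour set). -/
noncomputable def deg {V : Type} (G : SimpleGraph V) (v : V) : ℕ := (G.neighborSet v).ncard

/-- Minimum degree. -/
noncomputable def minDeg {V : Type} (G : SimpleGraph V) : ℕ := sInf (Set.range (deg G))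

/-- Maximum degree. -/
noncomputable def maxDeg {V : Type} (G : SimpleGraph V) : ℕ := sSup (Set.range (deg G))

/-- Number of edges of `G` with both endpoints in `S`. -/
noncomputable def eIn {V : Type} (G : SimpleGraph V) (S : Set V) : ℕ :=
  {e ∈ G.edgeSet | ∀ v ∈ e, v ∈ S}.ncard

/-- Number of edges of `G` with one endpoint in `S` and the other in `T`. -/
noncomputable def eBtw {V : Type} (G : SimpleGraph V) (S T : Set V) : ℕ :=
  {e ∈ G.edgeSet | ∃ a ∈ S, ∃ b ∈ T, e = s(a, b)}.ncard

/-- `G` is `(p, β)`-jumbled. -/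
def IsJumbled {V : Type} (G : SimpleGraph V) (p β : ℝ) : Prop :=
  ∀ S : Set V, |(eIn G S : ℝ) - p * ((S.ncard : ℝ) * ((S.ncard : ℝ) - 1) / 2)| ≤ β * S.ncard

/-- `G` is strongly `2`-jumping. -/
def StronglyTwoJumping (n : ℕ) (G : SimpleGraph (Fin n)) : Prop :=
  ∀ T : Set (Fin n), T.Nonempty →
    (∑ v ∈ (Set.toFinite T).toFinset, (deg G v : ℝ)) / (T.ncard : ℝ) ≥
      (minDeg G : ℝ) + min ((T.ncard : ℝ) - 1) ((Real.log n) ^ 2)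

/-- `G` is `p`-pseudorandom. -/
def IsPseudorandom (n : ℕ) (G : SimpleGraph (Fin n)) (p : ℝ) : Prop :=
  IsJumbled G p (2 * Real.sqrt (n * p * (1 - p))) ∧
  (∀ S T : Set (Fin n), Disjoint S T →
    ((1 / (S.ncard : ℝ) + 1 / (T.ncard : ℝ)) * Real.log n / p ≥ 7 / 2 →
      (eBtw G S T : ℝ) ≤ 2 * ((S.ncard : ℝ) + (T.ncard : ℝ)) * Real.log n) ∧
    ((1 / (S.ncard : ℝ) + 1 / (T.ncard : ℝ)) * Real.log n / p ≤ 7 / 2 →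
      (eBtw G S T : ℝ) ≤ 7 * (S.ncard : ℝ) * (T.ncard : ℝ) * p)) ∧
  (∀ S : Set (Fin n),
    (Real.log n / ((S.ncard : ℝ) * p) ≥ 7 / 4 → (eIn G S : ℝ) ≤ 2 * (S.ncard : ℝ) * Real.log n) ∧
    (Real.log n / ((S.ncard : ℝ) * p) ≤ 7 / 4 → (eIn G S : ℝ) ≤ 7 * (S.ncard : ℝ) ^ 2 * p / 2)) ∧
  ((n : ℝ) * p - 2 * Real.sqrt ((n : ℝ) * p * Real.log n) ≤ (minDeg G : ℝ) ∧
    (minDeg G : ℝ) ≤ (n : ℝ) * p - 200 * Real.sqrt ((n : ℝ) * p * (1 - p)) ∧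
    (maxDeg G : ℝ) ≤ (n : ℝ) * p + 2 * Real.sqrt ((n : ℝ) * p * Real.log n)) ∧
  StronglyTwoJumping n G

/-- `G` is `u`-jumping. -/
def IsJumping (n : ℕ) (G : SimpleGraph (Fin n)) (u : ℝ) : Prop :=
  ∃ x₀ : Fin n, deg G x₀ = minDeg G ∧
    ∀ x : Fin n, x ≠ x₀ → (deg G x : ℝ) ≥ (minDeg G : ℝ) + u

/-- `C` is a Hamilton cycle (on the whole vertex set `Fin n`). -/
def IsHamCycle {n : ℕ} (C : SimpleGraph (Fin n)) : Prop :=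
  ∃ (v : Fin n) (w : C.Walk v v), w.IsHamiltonianCycle ∧ C.edgeSet = {e | e ∈ w.edges}

/-- `G` has property `H`. -/
def HasPropertyH (n : ℕ) (G : SimpleGraph (Fin n)) : Prop :=
  ∃ HC : Fin (minDeg G / 2) → SimpleGraph (Fin n),
    (∀ i, HC i ≤ G ∧ IsHamCycle (HC i)) ∧
    (∀ i j, i ≠ j → Disjoint (HC i).edgeSet (HC j).edgeSet) ∧
    (Odd (minDeg G) →
      ∃ M : SimpleGraph (Fin n), M ≤ G ∧ (∀ v, deg M v ≤ 1) ∧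
        M.edgeSet.ncard = n / 2 ∧ ∀ i, Disjoint M.edgeSet (HC i).edgeSet)

/-- Probability of the event `A` under the binomial random graph `G_{n,p}`. -/
noncomputable def gnpProb (n : ℕ) (p : ℝ) (A : SimpleGraph (Fin n) → Prop) : ℝ :=
  ∑ G : SimpleGraph (Fin n),
    if A G then p ^ G.edgeSet.ncard * (1 - p) ^ (n.choose 2 - G.edgeSet.ncard) else 0


/-- Number of cycles of a 2-regular graph = number of connected components. -/
noncomputable def numCycles {V : Type} (F : SimpleGraph V) : ℕ := Nat.card F.ConnectedComponent

/-- `N` is a perfect matching on the whole vertex set. -/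
def IsPerfectMatchingGraph {n : ℕ} (N : SimpleGraph (Fin n)) : Prop :=
  ∀ v, ((N.neighborSet v).ncard) = 1

/-- `N` is a perfect pseudomatching: one vertex of degree 2, all others of degree 1. -/
def IsPerfectPseudomatching {n : ℕ} (N : SimpleGraph (Fin n)) : Prop :=
  ∃ w, ((N.neighborSet w).ncard) = 2 ∧ ∀ v, v ≠ w → ((N.neighborSet v).ncard) = 1

/-- A set of edges forms a matching (no two distinct edges share a vertex). -/
def IsMatchingSet {n : ℕ} (E : Set (Sym2 (Fin n))) : Prop :=
  ∀ e ∈ E, ∀ f ∈ E, e ≠ f → ∀ v : Fin n, v ∈ e → v ∉ f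

/-- Number of cycles (orbits, including fixed points) of a permutation. -/
noncomputable def cycleCount {α : Type} (σ : Equiv.Perm α) : ℕ :=
  Nat.card (Quotient (⟨σ.SameCycle,
    ⟨fun x => Equiv.Perm.SameCycle.refl σ x, fun h => h.symm, fun h h' => h.trans h'⟩⟩ : Setoid α))

/-- Edges of the bipartite graph given by the relation `R` between `S` and `T`. -/
noncomputable def eBip {n : ℕ} (R : Fin n → Fin n → Prop) (S T : Set (Fin n)) : ℕ :=
  {q : Fin n × Fin n | q.1 ∈ S ∧ q.2 ∈ T ∧ R q.1 q.2}.ncard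

/-- One rotation of a path (represented as a list of vertices), with new edge from `H`
and pivot in `Q`. -/
def RotStep {V : Type} (H : SimpleGraph V) (Q : Set V) (l l' : List V) : Prop :=
  ∃ (x : V) (a : List V) (p : V) (b : List V),
    l = (x :: a) ++ p :: b ∧ l' = (x :: a).reverse ++ p :: b ∧ p ∈ Q ∧ H.Adj x p

/-- `v` is `(H, Q, τ)`-reachable from the path `l`. -/
def ReachableVert {V : Type} (H : SimpleGraph V) (Q : Set V) (τ : ℕ) (l : List V) (v : V) : Prop :=
  ∃ (k : ℕ) (f : ℕ → List V), k ≤ τ ∧ f 0 = l ∧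
    (∀ i < k, RotStep H Q (f i) (f (i + 1))) ∧ (f k).head? = some v

/-- External neighbourhood. -/
def extNbhd {V : Type} (H : SimpleGraph V) (S : Set V) : Set V :=
  (⋃ x ∈ S, H.neighborSet x) \ S

end EDHC

theorem exp_le_one_add_add_sq {x : ℝ} (hx : |x| ≤ 1) : Real.exp x ≤ 1 + x + 3 / 4 * x ^ 2 := by
  have := (abs_le.1 (Real.exp_bound hx (n := 2) (by norm_num))).2
  norm_num [Finset.sum_range_succ, Nat.factorial] at this
  linarith

theorem bernoulli_mgf_le {p t : ℝ} (h0 : 0 ≤ p) (h1 : p ≤ 1) (ht : |t| ≤ 1) :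
    1 - p + p * Real.exp t ≤ Real.exp (t * p + 3 / 4 * (p * (1 - p)) * t ^ 2) := by
  have hq : 0 ≤ 1 - p := by linarith
  have e1 := exp_le_one_add_add_sq (x := -(p * t)) (by
    rw [abs_neg, abs_mul, abs_of_nonneg h0]; nlinarith [abs_nonneg t])
  have e2 := exp_le_one_add_add_sq (x := (1 - p) * t) (by
    rw [abs_mul, abs_of_nonneg hq]; nlinarith [abs_nonneg t])
  have e3 : (1 - p) * Real.exp (-(p * t)) + p * Real.exp ((1 - p) * t) ≤
      Real.exp (3 / 4 * (p * (1 - p)) * t ^ 2) := by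
    refine le_trans ?_ (Real.add_one_le_exp _)
    nlinarith [mul_le_mul_of_nonneg_left e1 hq, mul_le_mul_of_nonneg_left e2 h0]
  calc 1 - p + p * Real.exp t
      = Real.exp (t * p) * ((1 - p) * Real.exp (-(p * t)) + p * Real.exp ((1 - p) * t)) := by
        have a1 : Real.exp (t * p) * Real.exp (-(p * t)) = 1 := by
          rw [← Real.exp_add]; ring_nf; exact Real.exp_zero
        have a2 : Real.exp (t * p) * Real.exp ((1 - p) * t) = Real.exp t := by
          rw [← Real.exp_add]; ring_nf
        linear_combination (-(1 - p)) * a1 - p * a2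
    _ ≤ _ := by
        rw [Real.exp_add]
        exact mul_le_mul_of_nonneg_left e3 (Real.exp_pos _).le

section Bernoulli

variable {α : Type*}

/-- Expectation of `f S`, where `S` is the random subset of `E` that contains each element
independently with probability `p`. -/
noncomputable def bernExp (p : ℝ) (E : Finset α) (f : Finset α → ℝ) : ℝ :=
  ∑ S ∈ E.powerset, p ^ S.card * (1 - p) ^ (E.card - S.card) * f S

/-- Probability that the `p`-random subset of `E` satisfies `A`. -/
noncomputable def bernProb (p : ℝ) (E : Finset α) (A : Finset α → Prop) : ℝ :=
  bernExp p E (fun S => if A S then 1 else 0)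

theorem bernExp_congr {p : ℝ} {E : Finset α} {f g : Finset α → ℝ}
    (h : ∀ S ⊆ E, f S = g S) : bernExp p E f = bernExp p E g :=
  Finset.sum_congr rfl fun S hS => by rw [h S (Finset.mem_powerset.1 hS)]

theorem bernExp_mono {p : ℝ} (h0 : 0 ≤ p) (h1 : p ≤ 1) {E : Finset α} {f g : Finset α → ℝ}
    (h : ∀ S ⊆ E, f S ≤ g S) : bernExp p E f ≤ bernExp p E g := by
  refine Finset.sum_le_sum fun S hS => ?_
  have : 0 ≤ 1 - p := by linarith
  exact mul_le_mul_of_nonneg_left (h S (Finset.mem_powerset.1 hS)) (by positivity)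

theorem bernExp_const_mul (p c : ℝ) (E : Finset α) (f : Finset α → ℝ) :
    bernExp p E (fun S => c * f S) = c * bernExp p E f := by
  rw [bernExp, bernExp, Finset.mul_sum]
  exact Finset.sum_congr rfl fun S _ => by ring

theorem bernExp_add (p : ℝ) (E : Finset α) (f g : Finset α → ℝ) :
    bernExp p E (fun S => f S + g S) = bernExp p E f + bernExp p E g := by
  rw [bernExp, bernExp, bernExp, ← Finset.sum_add_distrib]
  exact Finset.sum_congr rfl fun S _ => by ring

theorem bernExp_sum {ι : Type*} (p : ℝ) (E : Finset α) (s : Finset ι) (f : ι → Finset α → ℝ) :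
    bernExp p E (fun S => ∑ i ∈ s, f i S) = ∑ i ∈ s, bernExp p E (f i) := by
  simp only [bernExp, Finset.mul_sum]
  exact Finset.sum_comm

theorem bernExp_empty (p : ℝ) (f : Finset α → ℝ) : bernExp p ∅ f = f ∅ := by
  simp [bernExp]

theorem bernExp_card (p : ℝ) (E : Finset α) (f : ℕ → ℝ) :
    bernExp p E (fun S => f S.card) =
      ∑ k ∈ Finset.range (E.card + 1), E.card.choose k * p ^ k * (1 - p) ^ (E.card - k) * f k := by
  rw [bernExp, Finset.sum_powerset_apply_card (fun k => p ^ k * (1 - p) ^ (E.card - k) * f k)]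
  exact Finset.sum_congr rfl fun k _ => by rw [nsmul_eq_mul]; ring

theorem bernProb_mono {p : ℝ} (h0 : 0 ≤ p) (h1 : p ≤ 1) {E : Finset α} {A B : Finset α → Prop}
    (h : ∀ S ⊆ E, A S → B S) : bernProb p E A ≤ bernProb p E B := by
  refine bernExp_mono h0 h1 fun S hS => ?_
  have := h S hS
  split_ifs <;> first | tauto | norm_num

theorem bernProb_or_le {p : ℝ} (h0 : 0 ≤ p) (h1 : p ≤ 1) (E : Finset α) (A B : Finset α → Prop) :
    bernProb p E (fun S => A S ∨ B S) ≤ bernProb p E A + bernProb p E B := by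
  rw [bernProb, bernProb, bernProb, ← bernExp_add]
  refine bernExp_mono h0 h1 fun S _ => ?_
  by_cases hA : A S <;> by_cases hB : B S <;> simp [hA, hB]

theorem bernProb_or_le_add {p : ℝ} (h0 : 0 ≤ p) (h1 : p ≤ 1) {E : Finset α}
    {A B : Finset α → Prop} {a b : ℝ} (hA : bernProb p E A ≤ a) (hB : bernProb p E B ≤ b) :
    bernProb p E (fun S => A S ∨ B S) ≤ a + b :=
  (bernProb_or_le h0 h1 E A B).trans (add_le_add hA hB)

theorem bernProb_exists_le {ι : Type*} {p : ℝ} (h0 : 0 ≤ p) (h1 : p ≤ 1) (E : Finset α)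
    (s : Finset ι) (A : ι → Finset α → Prop) :
    bernProb p E (fun S => ∃ i ∈ s, A i S) ≤ ∑ i ∈ s, bernProb p E (A i) := by
  simp only [bernProb]
  rw [← bernExp_sum]
  refine bernExp_mono h0 h1 fun S _ => ?_
  have hn : ∀ i ∈ s, (0 : ℝ) ≤ if A i S then 1 else 0 := fun i _ => by split_ifs <;> norm_num
  split_ifs with h
  · obtain ⟨i, hi, hA⟩ := h
    have := Finset.single_le_sum hn hi
    simpa [hA] using this
  · exact Finset.sum_nonneg hn

variable [DecidableEq α]

theorem bernExp_insert (p : ℝ) {E : Finset α} {a : α} (ha : a ∉ E) (f : Finset α → ℝ) :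
    bernExp p (insert a E) f =
      (1 - p) * bernExp p E f + p * bernExp p E (fun S => f (insert a S)) := by
  rw [bernExp, Finset.sum_powerset_insert ha, bernExp, bernExp, Finset.mul_sum, Finset.mul_sum]
  congr 1
  · refine Finset.sum_congr rfl fun S hS => ?_
    have hc := Finset.card_le_card (Finset.mem_powerset.1 hS)
    rw [Finset.card_insert_of_notMem ha, Nat.succ_sub hc, pow_succ]
    ring
  · refine Finset.sum_congr rfl fun S hS => ?_
    have haS : a ∉ S := fun h => ha (Finset.mem_powerset.1 hS h)
    rw [Finset.card_insert_of_notMem ha, Finset.card_insert_of_notMem haS,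
      Nat.add_sub_add_right, pow_succ]
    ring

/-- Fubini: the restrictions of the random set to disjoint sets are independent. -/
theorem bernExp_union (p : ℝ) {A B : Finset α} (h : Disjoint A B) (f : Finset α → ℝ) :
    bernExp p (A ∪ B) f = bernExp p A (fun S => bernExp p B (fun T => f (S ∪ T))) := by
  induction A using Finset.induction_on generalizing f with
  | empty => simp [bernExp_empty]
  | insert a A ha ih =>
    rw [Finset.disjoint_insert_left] at h
    rw [Finset.insert_union, bernExp_insert p (by simp [ha, h.1]), bernExp_insert p ha,
      ih h.2, ih h.2]
    simp only [Finset.insert_union]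

theorem bernExp_const (p c : ℝ) (E : Finset α) : bernExp p E (fun _ => c) = c := by
  induction E using Finset.induction_on with
  | empty => simp [bernExp_empty]
  | insert a A ha ih => rw [bernExp_insert p ha, ih]; ring

theorem bernExp_inter (p : ℝ) {E F : Finset α} (hF : F ⊆ E) (f : Finset α → ℝ) :
    bernExp p E (fun S => f (S ∩ F)) = bernExp p F f := by
  conv_lhs => rw [← Finset.union_sdiff_of_subset hF]
  rw [bernExp_union p Finset.disjoint_sdiff]
  refine bernExp_congr fun S hS => ?_
  rw [← bernExp_const p (f S) (E \ F)]
  refine bernExp_congr fun T hT => ?_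
  congr 1
  ext x
  have h1 := @hS x
  have h2 := @hT x
  simp only [Finset.mem_inter, Finset.mem_union, Finset.mem_sdiff] at *
  tauto

theorem bernExp_prod_card_inter {ι : Type*} (p : ℝ) (A : Finset ι) (E : Finset α)
    (F : ι → Finset α) (hF : ∀ i ∈ A, F i ⊆ E)
    (hd : ∀ i ∈ A, ∀ j ∈ A, i ≠ j → Disjoint (F i) (F j)) (h : ℕ → ℝ) :
    bernExp p E (fun S => ∏ i ∈ A, h (S ∩ F i).card) =
      ∏ i ∈ A, bernExp p (F i) (fun S => h S.card) := by
  classical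
  induction A using Finset.induction_on generalizing E with
  | empty => simp [bernExp_const]
  | insert a A ha ih =>
    rw [Finset.prod_insert ha]
    have haE := hF a (Finset.mem_insert_self _ _)
    have hdis : ∀ i ∈ A, Disjoint (F i) (F a) := fun i hi =>
      hd i (Finset.mem_insert_of_mem hi) a (Finset.mem_insert_self _ _) (by rintro rfl; exact ha hi)
    rw [← ih (E \ F a)
      (fun i hi => Finset.subset_sdiff.2 ⟨hF i (Finset.mem_insert_of_mem hi), hdis i hi⟩)
      (fun i hi j hj => hd i (Finset.mem_insert_of_mem hi) j (Finset.mem_insert_of_mem hj))]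
    conv_lhs => rw [← Finset.union_sdiff_of_subset haE]
    rw [bernExp_union p Finset.disjoint_sdiff, mul_comm, ← bernExp_const_mul]
    refine bernExp_congr fun S hS => ?_
    rw [mul_comm, ← bernExp_const_mul]
    refine bernExp_congr fun T hT => ?_
    rw [Finset.prod_insert ha]
    congr 1
    · congr 2
      ext x
      have h1 := @hS x
      have h2 := @hT x
      simp only [Finset.mem_inter, Finset.mem_union, Finset.mem_sdiff] at *
      tauto
    · refine Finset.prod_congr rfl fun i hi => ?_
      congr 2
      ext x
      have h1 := @hS x
      have h3 : x ∈ F i → x ∉ F a := fun h => Finset.disjoint_left.1 (hdis i hi) h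
      simp only [Finset.mem_inter, Finset.mem_union] at *
      tauto

theorem bernExp_exp_card_inter (p t : ℝ) {E F : Finset α} (hF : F ⊆ E) :
    bernExp p E (fun S => Real.exp (t * (S ∩ F).card)) = (1 - p + p * Real.exp t) ^ F.card := by
  rw [bernExp_inter p hF (fun S => Real.exp (t * S.card))]
  induction F using Finset.induction_on with
  | empty => simp [bernExp_empty]
  | insert a A ha ih =>
    rw [bernExp_insert p ha, Finset.card_insert_of_notMem ha, pow_succ,
      ← ih ((Finset.subset_insert a A).trans hF)]
    have : bernExp p A (fun S => Real.exp (t * (insert a S).card)) =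
        Real.exp t * bernExp p A (fun S => Real.exp (t * S.card)) := by
      rw [← bernExp_const_mul]
      refine bernExp_congr fun S hS => ?_
      rw [Finset.card_insert_of_notMem fun h => ha (hS h), ← Real.exp_add]
      push_cast
      congr 1
      ring
    rw [this]
    ring

/-- Markov's inequality applied to an exponential moment. -/
theorem bernProb_le_exp_mul {p : ℝ} (h0 : 0 ≤ p) (h1 : p ≤ 1) (t y : ℝ) {E F : Finset α}
    (hF : F ⊆ E) :
    bernProb p E (fun S => y ≤ t * (S ∩ F).card) ≤
      Real.exp (-y) * (1 - p + p * Real.exp t) ^ F.card := by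
  rw [← bernExp_exp_card_inter p t hF, ← bernExp_const_mul]
  refine bernExp_mono h0 h1 fun S _ => ?_
  rw [← Real.exp_add]
  split_ifs with h
  · exact Real.one_le_exp (by linarith)
  · positivity

/-- Bernstein-type tail bound; negative `t` gives the lower tail. -/
theorem bernProb_deviation_le {p : ℝ} (h0 : 0 ≤ p) (h1 : p ≤ 1) {t : ℝ} (ht : |t| ≤ 1) (y : ℝ)
    {E F : Finset α} (hF : F ⊆ E) :
    bernProb p E (fun S => y ≤ t * ((S ∩ F).card - F.card * p)) ≤
      Real.exp (3 / 4 * (F.card * p * (1 - p)) * t ^ 2 - y) := by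
  have hb : 0 ≤ 1 - p + p * Real.exp t := by
    have := Real.exp_pos t
    have : 0 ≤ 1 - p := by linarith
    positivity
  calc _ ≤ bernProb p E (fun S => y + t * (F.card * p) ≤ t * (S ∩ F).card) :=
        bernProb_mono h0 h1 fun S _ h => by linarith
    _ ≤ Real.exp (-(y + t * (F.card * p))) * (1 - p + p * Real.exp t) ^ F.card :=
        bernProb_le_exp_mul h0 h1 t _ hF
    _ ≤ Real.exp (-(y + t * (F.card * p))) *
          Real.exp (t * p + 3 / 4 * (p * (1 - p)) * t ^ 2) ^ F.card := by
        gcongr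
        exact bernoulli_mgf_le h0 h1 ht
    _ = _ := by
        rw [← Real.exp_nat_mul, ← Real.exp_add]
        congr 1
        ring

/-- Upper tail far above the mean. -/
theorem bernProb_large_deviation_le {p k : ℝ} (h0 : 0 ≤ p) (h1 : p ≤ 1) {E F : Finset α}
    (hF : F ⊆ E) (hk : 7 * (F.card * p) ≤ k) :
    bernProb p E (fun S => k ≤ (S ∩ F).card) ≤ Real.exp (-(3 / 4 * k)) := by
  have he := Real.exp_one_lt_d9
  have hb : 0 ≤ 1 - p + p * Real.exp 1 := by
    have := Real.exp_pos 1
    have : 0 ≤ 1 - p := by linarith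
    positivity
  calc _ ≤ bernProb p E (fun S => k ≤ 1 * (S ∩ F).card) :=
        bernProb_mono h0 h1 fun S _ h => by linarith
    _ ≤ Real.exp (-k) * (1 - p + p * Real.exp 1) ^ F.card := bernProb_le_exp_mul h0 h1 1 _ hF
    _ ≤ Real.exp (-k) * Real.exp (7 / 4 * p) ^ F.card := by
        gcongr
        refine le_trans ?_ (Real.add_one_le_exp _)
        nlinarith
    _ ≤ _ := by
        rw [← Real.exp_nat_mul, ← Real.exp_add]
        apply Real.exp_le_exp.2
        linarith

end Bernoulli

section Binomial

/-- Point probabilities of the binomial distribution with parameters `N` and `p`. -/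
noncomputable def binomPmf (p : ℝ) (N k : ℕ) : ℝ := N.choose k * p ^ k * (1 - p) ^ (N - k)

theorem binomPmf_nonneg {p : ℝ} (h0 : 0 ≤ p) (h1 : p ≤ 1) (N k : ℕ) : 0 ≤ binomPmf p N k := by
  have : 0 ≤ 1 - p := by linarith
  unfold binomPmf
  positivity

theorem binomPmf_eq_zero {p : ℝ} {N k : ℕ} (h : N < k) : binomPmf p N k = 0 := by
  simp [binomPmf, Nat.choose_eq_zero_of_lt h]

theorem bernProb_card_mem {α : Type*} (p : ℝ) (E : Finset α) (s : Finset ℕ) :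
    bernProb p E (fun S => S.card ∈ s) = ∑ k ∈ s, binomPmf p E.card k := by
  refine (bernExp_congr fun S _ => ?_).trans
    ((bernExp_card p E fun k => if k ∈ s then (1 : ℝ) else 0).trans ?_)
  · by_cases h : S.card ∈ s <;> simp [h]
  simp only [mul_ite, mul_one, mul_zero]
  rw [← Finset.sum_filter]
  refine Finset.sum_subset (f := binomPmf p E.card) ?_ ?_
  · intro k hk
    exact (Finset.mem_filter.1 hk).2
  · intro k hk hk'
    apply binomPmf_eq_zero
    by_contra h
    exact hk' (Finset.mem_filter.2 ⟨Finset.mem_range.2 (by omega), hk⟩)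

theorem mul_binomPmf_succ_le {p D : ℝ} (h0 : 0 < p) (h1 : p < 1) (hD : 0 ≤ D) {N k : ℕ}
    (hk : (N + 1) * p - D ≤ k + 1) :
    (1 - D / ((N + 1) * p * (1 - p))) * binomPmf p N (k + 1) ≤ binomPmf p N k := by
  have hq : 0 < 1 - p := by linarith
  rcases lt_or_ge N (k + 1) with h | h
  · rw [binomPmf_eq_zero h, mul_zero]
    exact binomPmf_nonneg h0.le h1.le N k
  obtain ⟨m, rfl⟩ := Nat.exists_eq_add_of_le h
  have hrec : binomPmf p (k + 1 + m) (k + 1) * ((k + 1) * (1 - p)) =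
      binomPmf p (k + 1 + m) k * ((m + 1) * p) := by
    have hc := Nat.choose_succ_right_eq (k + 1 + m) k
    have e : k + 1 + m - k = m + 1 := by omega
    have e' : k + 1 + m - (k + 1) = m := by omega
    rw [e] at hc
    have hc' : ((k + 1 + m).choose (k + 1) : ℝ) * (k + 1) = (k + 1 + m).choose k * (m + 1) := by
      exact_mod_cast hc
    rw [binomPmf, binomPmf, e, e', pow_succ, pow_succ]
    linear_combination p ^ k * p * (1 - p) ^ m * (1 - p) * hc'
  push_cast at hk ⊢
  have hm : (0 : ℝ) < (m + 1) * p := by positivity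
  have hn : (0 : ℝ) < (k + 1 + m + 1) * p * (1 - p) := by positivity
  have hf := binomPmf_nonneg h0.le h1.le (k + 1 + m) (k + 1)
  refine le_of_mul_le_mul_right ?_ hm
  rw [← hrec, mul_right_comm, mul_comm]
  refine mul_le_mul_of_nonneg_left ?_ hf
  rw [sub_mul, one_mul, sub_le_iff_le_add, div_mul_eq_mul_div, ← sub_le_iff_le_add', le_div_iff₀ hn]
  obtain ⟨x, hx⟩ : ∃ x : ℝ, x = (k + 1 + m + 1) * p - (k + 1) := ⟨_, rfl⟩
  have hxD : x ≤ D := by linarith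
  have e1 : ((m : ℝ) + 1) * p - (k + 1) * (1 - p) = x := by rw [hx]; ring
  have e2 : ((m : ℝ) + 1) * p = (k + 1 + m + 1) * p * (1 - p) + x * p := by rw [hx]; ring
  rw [e1]
  rcases le_or_gt x 0 with hx0 | hx0
  · exact (mul_nonpos_of_nonpos_of_nonneg hx0 hn.le).trans (mul_nonneg hD hm.le)
  · rw [e2]
    nlinarith [mul_le_mul_of_nonneg_right hxD hn.le, mul_nonneg hD (mul_pos hx0 h0).le]

theorem pow_mul_binomPmf_add_le {p D : ℝ} (h0 : 0 < p) (h1 : p < 1) (hD : 0 ≤ D) {N k : ℕ}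
    (hD' : D ≤ (N + 1) * p * (1 - p)) (hk : (N + 1) * p - D ≤ k) (w : ℕ) :
    (1 - D / ((N + 1) * p * (1 - p))) ^ w * binomPmf p N (k + w) ≤ binomPmf p N k := by
  have hq : 0 < 1 - p := by linarith
  have hr : 0 ≤ 1 - D / ((N + 1) * p * (1 - p)) :=
    sub_nonneg.2 (div_le_one_of_le₀ hD' (by positivity))
  induction w with
  | zero => simp
  | succ w ih =>
    refine le_trans ?_ ih
    rw [pow_succ, mul_assoc]
    refine mul_le_mul_of_nonneg_left ?_ (pow_nonneg hr w)
    refine mul_binomPmf_succ_le h0 h1 hD ?_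
    have : (0 : ℝ) ≤ w := Nat.cast_nonneg w
    have e : ((k.add w : ℕ) : ℝ) = k + w := Nat.cast_add k w
    rw [e]
    linarith

/-- If `f` varies slowly, a block of `W` consecutive terms is dominated by the `J` preceding
blocks. -/
theorem mul_sum_block_le {f : ℕ → ℝ} (hf : ∀ k, 0 ≤ f k) {R : ℝ} {c W J : ℕ}
    (h : ∀ k, c ≤ k → ∀ w ≤ W * J, R * f (k + w) ≤ f k) :
    J * R * ∑ k ∈ Finset.Ico (c + W * J) (c + W * J + W), f k ≤
      ∑ k ∈ Finset.range (c + W * J), f k := by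
  have key : ∀ j ≤ J, j * R * ∑ k ∈ Finset.Ico (c + W * J) (c + W * J + W), f k ≤
      ∑ k ∈ Finset.range (c + W * j), f k := by
    intro j
    induction j with
    | zero => intro _; simpa using Finset.sum_nonneg fun k _ => hf k
    | succ j ih =>
      intro hj
      have e : c + W * (j + 1) = (c + W * j) + W := by ring
      rw [e, Finset.sum_range_add _ (c + W * j) W]
      push_cast
      have hW : W * j ≤ W * J := Nat.mul_le_mul_left W (by omega)
      have : R * ∑ k ∈ Finset.Ico (c + W * J) (c + W * J + W), f k ≤
          ∑ i ∈ Finset.range W, f (c + W * j + i) := by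
        rw [Finset.sum_Ico_eq_sum_range, Nat.add_sub_cancel_left, Finset.mul_sum]
        refine Finset.sum_le_sum fun i _ => ?_
        have := h (c + W * j + i) (by omega) (W * J - W * j) (by omega)
        have e' : c + W * j + i + (W * J - W * j) = c + W * J + i := by omega
        rwa [e'] at this
      linarith [ih (by omega)]
  exact key J le_rfl

/-- Each point of the window `[a, a + W)` of a binomial variable has small mass compared to the
tail below `a`, provided `a` is not too far below the mean. -/
theorem binom_window_le {p D : ℝ} (h0 : 0 < p) (h1 : p < 1) (hD : 0 ≤ D) {N a W J : ℕ}
    (ha : (N + 1) * p - D + W * J ≤ a) (hp : 0 ≤ (N + 1) * p - D)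
    (hWJ : W * J * D ≤ 1 / 5 * ((N + 1) * p * (1 - p))) (hJ : 0 < W * J) :
    J * (4 / 5) * ∑ k ∈ Finset.Ico a (a + W), binomPmf p N k ≤
      ∑ k ∈ Finset.range a, binomPmf p N k := by
  have hq : 0 < 1 - p := by linarith
  have hpos : 0 < (N + 1) * p * (1 - p) := by positivity
  have hJ1 : (1 : ℝ) ≤ W * J := by exact_mod_cast hJ
  have hDle : D ≤ 1 / 5 * ((N + 1) * p * (1 - p)) := by nlinarith
  have haWJ : W * J ≤ a := by
    have : ((W * J : ℕ) : ℝ) ≤ a := by push_cast; linarith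
    exact_mod_cast this
  obtain ⟨c, rfl⟩ := Nat.exists_eq_add_of_le' haWJ
  have hc : (N + 1) * p - D ≤ c := by push_cast at ha; linarith
  refine mul_sum_block_le (binomPmf_nonneg h0.le h1.le N) fun k hk w hw => ?_
  have hkc : (c : ℝ) ≤ k := by exact_mod_cast hk
  refine le_trans ?_ (pow_mul_binomPmf_add_le h0 h1 hD (by linarith) (hc.trans hkc) w)
  refine mul_le_mul_of_nonneg_right ?_ (binomPmf_nonneg h0.le h1.le _ _)
  have hx : D / ((N + 1) * p * (1 - p)) ≤ 1 / 5 := by rwa [div_le_iff₀ hpos]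
  have hb := one_add_mul_le_pow (a := -(D / ((N + 1) * p * (1 - p)))) (by linarith) w
  rw [← sub_eq_add_neg] at hb
  refine le_trans ?_ hb
  have hw' : (w : ℝ) ≤ W * J := by exact_mod_cast hw
  have : w * (D / ((N + 1) * p * (1 - p))) ≤ 1 / 5 := by
    rw [← mul_div_assoc, div_le_iff₀ hpos]
    nlinarith
  linarith

theorem bernProb_central_ge {α : Type*} [DecidableEq α] {p σ : ℝ} (h0 : 0 < p) (h1 : p < 1)
    {E : Finset α} (hσ : 1 ≤ σ) (hσ2 : E.card * p * (1 - p) ≤ σ ^ 2) :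
    1 / 2 ≤ bernProb p E (fun S => |(S.card : ℝ) - E.card * p| < 3 * σ) := by
  have hσ0 : 0 < σ := by linarith
  have hinv : |1 / σ| ≤ 1 := by rw [abs_of_pos (by positivity)]; exact div_le_one_of_le₀ hσ hσ0.le
  have hmul : E.card * p * (1 - p) * (1 / σ) ^ 2 ≤ 1 := by
    rw [one_div, inv_pow, ← div_eq_mul_inv]
    exact div_le_one_of_le₀ hσ2 (by positivity)
  have he : Real.exp (-2) ≤ 1 / 4 := by
    have h2 : (2 : ℝ) ≤ Real.exp 1 := by linarith [Real.add_one_le_exp (1 : ℝ)]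
    have h4 : Real.exp 2 = Real.exp 1 * Real.exp 1 := by rw [← Real.exp_add]; norm_num
    rw [Real.exp_neg, one_div]
    exact inv_anti₀ (by norm_num) (by rw [h4]; nlinarith)
  have hU : bernProb p E (fun S => 3 ≤ (1 / σ) * ((S ∩ E).card - E.card * p)) ≤ 1 / 4 :=
    (bernProb_deviation_le h0.le h1.le hinv 3 subset_rfl).trans
      ((Real.exp_le_exp.2 (by linarith)).trans he)
  have hL : bernProb p E (fun S => 3 ≤ (-(1 / σ)) * ((S ∩ E).card - E.card * p)) ≤ 1 / 4 :=
    (bernProb_deviation_le h0.le h1.le (by rwa [abs_neg]) 3 subset_rfl).trans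
      ((Real.exp_le_exp.2 (by rw [neg_sq]; linarith)).trans he)
  have hall : (1 : ℝ) ≤ bernProb p E (fun S => |(S.card : ℝ) - E.card * p| < 3 * σ ∨
      (3 ≤ (1 / σ) * ((S ∩ E).card - E.card * p) ∨
        3 ≤ (-(1 / σ)) * ((S ∩ E).card - E.card * p))) := by
    refine (bernExp_const p 1 E).symm.le.trans (bernExp_mono h0.le h1.le fun S hS => ?_)
    rw [if_pos]
    by_contra hcon
    push Not at hcon
    obtain ⟨c1, c2, c3⟩ := hcon
    rw [Finset.inter_eq_left.2 hS] at c2 c3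
    rw [one_div, inv_mul_lt_iff₀ hσ0] at c2
    rw [neg_mul, ← mul_neg, one_div, inv_mul_lt_iff₀ hσ0] at c3
    rcases le_abs.1 c1 with h | h <;> linarith
  have h' := bernProb_or_le h0.le h1.le E (fun S => |(S.card : ℝ) - E.card * p| < 3 * σ)
    (fun S => 3 ≤ (1 / σ) * ((S ∩ E).card - E.card * p) ∨
        3 ≤ (-(1 / σ)) * ((S ∩ E).card - E.card * p))
  have h'' := bernProb_or_le h0.le h1.le E
    (fun S => 3 ≤ (1 / σ) * ((S ∩ E).card - E.card * p))
    (fun S => 3 ≤ (-(1 / σ)) * ((S ∩ E).card - E.card * p))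
  linarith

theorem exp_neg_two_mul_le {x : ℝ} (h0 : 0 ≤ x) (h1 : x ≤ 1 / 2) : Real.exp (-(2 * x)) ≤ 1 - x := by
  rw [Real.exp_neg]
  have h := Real.add_one_le_exp (2 * x)
  refine inv_le_of_inv_le₀ (by linarith) (le_trans ?_ h)
  rw [inv_le_comm₀ (by linarith) (by linarith), inv_le_iff_one_le_mul₀ (by linarith)]
  nlinarith

/-- A binomial variable is at least `201` standard deviations below its mean with probability
bounded away from zero. -/
theorem bernProb_card_le_ge {α : Type*} [DecidableEq α] {p σ : ℝ} (h0 : 0 < p) (h1 : p < 1)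
    {E : Finset α} {n : ℕ} (hn : E.card ≤ n) (hn2 : n ≤ 2 * E.card)
    (hσ : 1000 ≤ σ) (hσ2 : σ ^ 2 = n * p * (1 - p)) :
    1 / 2 * Real.exp (-171380) ≤
      bernProb p E (fun S => (S.card : ℝ) ≤ n * p - 201 * σ) := by
  set N := E.card with hN
  have hq : 0 < 1 - p := by linarith
  have hNn : (N : ℝ) ≤ n := by exact_mod_cast hn
  have hnN : (n : ℝ) ≤ 2 * N := by exact_mod_cast hn2
  have hpq : 0 < p * (1 - p) := by positivity
  have hNs : σ ^ 2 ≤ 2 * (N * p) := by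
    have : (n : ℝ) * p * (1 - p) ≤ n * p := by
      have : 0 ≤ (n : ℝ) * p := by positivity
      nlinarith
    nlinarith
  have hNv : σ ^ 2 / 2 ≤ (N + 1) * p * (1 - p) := by nlinarith
  have hpos : 0 < (N + 1) * p * (1 - p) := by positivity
  set w := ⌈204 * σ⌉₊ with hw
  have hw1 : 204 * σ ≤ w := Nat.le_ceil _
  have hw2 : (w : ℝ) ≤ 205 * σ := by
    have := Nat.ceil_lt_add_one (a := 204 * σ) (by linarith)
    linarith
  have hx : 209 * σ / ((N + 1) * p * (1 - p)) ≤ 418 / σ := by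
    rw [div_le_div_iff₀ hpos (by linarith)]
    nlinarith
  have hr : Real.exp (-(836 / σ)) ≤ 1 - 209 * σ / ((N + 1) * p * (1 - p)) := by
    have h := exp_neg_two_mul_le (x := 418 / σ) (by positivity)
      (by rw [div_le_iff₀ (by linarith)]; linarith)
    have e : 2 * (418 / σ) = 836 / σ := by ring
    rw [e] at h
    linarith
  have hrw : Real.exp (-171380) ≤ (1 - 209 * σ / ((N + 1) * p * (1 - p))) ^ w := by
    refine le_trans ?_ (pow_le_pow_left₀ (Real.exp_pos _).le hr w)
    rw [← Real.exp_nat_mul]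
    apply Real.exp_le_exp.2
    have : w * (836 / σ) ≤ 171380 := by
      rw [← mul_div_assoc, div_le_iff₀ (by linarith)]
      linarith
    linarith
  set s := (Finset.range (N + 1)).filter (fun k : ℕ => |(k : ℝ) - N * p| < 3 * σ) with hs
  have hmem : ∀ k ∈ s, w ≤ k ∧ (N + 1) * p - 209 * σ ≤ ((k - w : ℕ) : ℝ) ∧
      ((k - w : ℕ) : ℝ) ≤ n * p - 201 * σ := by
    intro k hk
    obtain ⟨hk1, hk2⟩ := abs_lt.1 (Finset.mem_filter.1 hk).2
    have hwk : (w : ℝ) ≤ k := by nlinarith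
    have hwk' : w ≤ k := by exact_mod_cast hwk
    refine ⟨hwk', ?_, ?_⟩ <;> rw [Nat.cast_sub hwk'] <;> nlinarith
  have hcent : 1 / 2 ≤ ∑ k ∈ s, binomPmf p N k := by
    rw [← bernProb_card_mem]
    refine (bernProb_central_ge h0 h1 (by linarith : 1 ≤ σ) ?_).trans
      (bernProb_mono h0.le h1.le fun S hS h => ?_)
    · rw [hσ2]
      nlinarith
    · have := Finset.card_le_card hS
      exact Finset.mem_filter.2 ⟨Finset.mem_range.2 (by omega), h⟩
  have hD' : 209 * σ ≤ (N + 1) * p * (1 - p) := by nlinarith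
  calc 1 / 2 * Real.exp (-171380)
      ≤ (∑ k ∈ s, binomPmf p N k) * (1 - 209 * σ / ((N + 1) * p * (1 - p))) ^ w := by gcongr
    _ ≤ ∑ k ∈ s, binomPmf p N (k - w) := by
        rw [Finset.sum_mul]
        refine Finset.sum_le_sum fun k hk => ?_
        obtain ⟨m1, m2, _⟩ := hmem k hk
        have := pow_mul_binomPmf_add_le h0 h1 (by linarith) hD' m2 w
        rwa [Nat.sub_add_cancel m1, mul_comm] at this
    _ = ∑ k ∈ s.image (· - w), binomPmf p N k := by
        rw [Finset.sum_image]
        intro a ha b hb hab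
        have := (hmem a ha).1
        have := (hmem b hb).1
        simp only at hab
        omega
    _ ≤ _ := by
        rw [← bernProb_card_mem]
        refine bernProb_mono h0.le h1.le fun S _ h => ?_
        obtain ⟨k, hk, hk'⟩ := Finset.mem_image.1 h
        rw [← hk']
        exact (hmem k hk).2.2

end Binomial

section RandomGraph

open EDHC

variable {n : ℕ}

/-- The potential edges of a graph on `Fin n`. -/
noncomputable def pairs (n : ℕ) : Finset (Sym2 (Fin n)) := Finset.univ.filter fun e => ¬ e.IsDiag

theorem mem_pairs {e : Sym2 (Fin n)} : e ∈ pairs n ↔ ¬ e.IsDiag := by simp [pairs]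

theorem card_pairs (n : ℕ) : (pairs n).card = n.choose 2 := by
  rw [pairs, ← Fintype.card_subtype, Sym2.card_subtype_not_diag, Fintype.card_fin]

theorem edgeSet_fromEdgeSet_of_subset {S : Finset (Sym2 (Fin n))} (hS : S ⊆ pairs n) :
    (fromEdgeSet (S : Set (Sym2 (Fin n)))).edgeSet = S := by
  rw [edgeSet_fromEdgeSet]
  ext e
  have := @hS e
  simp only [mem_pairs] at this
  simp only [Set.mem_sdiff, Finset.mem_coe, Sym2.mem_diagSet]
  tauto

theorem gnpProb_eq (n : ℕ) (p : ℝ) (A : SimpleGraph (Fin n) → Prop) :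
    gnpProb n p A = bernProb p (pairs n) (fun S => A (fromEdgeSet S)) := by
  rw [gnpProb, bernProb, bernExp, card_pairs]
  refine Finset.sum_bij' (fun G _ => (Set.toFinite G.edgeSet).toFinset)
    (fun S _ => fromEdgeSet (S : Set (Sym2 (Fin n)))) ?_ ?_ ?_ ?_ ?_
  · intro G _
    refine Finset.mem_powerset.2 fun e he => mem_pairs.2 ?_
    exact G.not_isDiag_of_mem_edgeSet ((Set.Finite.mem_toFinset _).1 he)
  · intro S _
    exact Finset.mem_univ _
  · intro G _
    simp
  · intro S hS
    ext e
    rw [Set.Finite.mem_toFinset, edgeSet_fromEdgeSet_of_subset (Finset.mem_powerset.1 hS)]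
    exact Finset.mem_coe
  · intro G _
    simp only [Set.Finite.coe_toFinset, fromEdgeSet_edgeSet]
    rw [Set.ncard_eq_toFinset_card _ (Set.toFinite G.edgeSet)]
    split_ifs <;> ring

/-- The pairs containing `v`. -/
noncomputable def starPairs (v : Fin n) : Finset (Sym2 (Fin n)) := (pairs n).filter (v ∈ ·)

/-- The pairs contained in `T`. -/
noncomputable def innerPairs (T : Finset (Fin n)) : Finset (Sym2 (Fin n)) :=
  (pairs n).filter fun e => ∀ v ∈ e, v ∈ T

/-- The pairs with one element in `S` and the other in `T`. -/
noncomputable def crossPairs (S T : Finset (Fin n)) : Finset (Sym2 (Fin n)) :=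
  (pairs n).filter fun e => ∃ a ∈ S, ∃ b ∈ T, e = s(a, b)

theorem starPairs_eq_image (v : Fin n) :
    starPairs v = (Finset.univ.erase v).image (fun w => s(v, w)) := by
  ext e
  induction e using Sym2.ind with
  | _ x y =>
    simp only [starPairs, Finset.mem_filter, mem_pairs, Sym2.mk_isDiag_iff, Sym2.mem_iff,
      Finset.mem_image, Finset.mem_erase, Finset.mem_univ, and_true, Sym2.eq_iff]
    constructor
    · rintro ⟨h, rfl | rfl⟩
      · exact ⟨y, Ne.symm h, Or.inl ⟨rfl, rfl⟩⟩
      · exact ⟨x, h, Or.inr ⟨rfl, rfl⟩⟩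
    · rintro ⟨w, hw, ⟨rfl, rfl⟩ | ⟨rfl, rfl⟩⟩
      · exact ⟨Ne.symm hw, Or.inl rfl⟩
      · exact ⟨hw, Or.inr rfl⟩

theorem card_image_mk (v : Fin n) (T : Finset (Fin n)) :
    (T.image (fun w => s(v, w))).card = T.card :=
  Finset.card_image_of_injective _ fun _ _ h => Sym2.congr_right.1 h

theorem card_starPairs (v : Fin n) : (starPairs v).card = n - 1 := by
  rw [starPairs_eq_image, card_image_mk, Finset.card_erase_of_mem (Finset.mem_univ v),
    Finset.card_univ, Fintype.card_fin]

theorem card_innerPairs (T : Finset (Fin n)) : (innerPairs T).card = T.card.choose 2 := by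
  rw [← Sym2.card_image_offDiag]
  congr 1
  ext e
  induction e using Sym2.ind with
  | _ x y =>
    simp only [innerPairs, Finset.mem_filter, mem_pairs, Sym2.mk_isDiag_iff, Sym2.mem_iff,
      Finset.mem_image, Finset.mem_offDiag, Prod.exists]
    constructor
    · rintro ⟨h, h'⟩
      exact ⟨x, y, ⟨h' x (Or.inl rfl), h' y (Or.inr rfl), h⟩, rfl⟩
    · rintro ⟨a, b, ⟨ha, hb, hab⟩, h⟩
      rcases Sym2.eq_iff.1 h with ⟨rfl, rfl⟩ | ⟨rfl, rfl⟩
      · exact ⟨hab, by rintro z (rfl | rfl) <;> assumption⟩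
      · exact ⟨Ne.symm hab, by rintro z (rfl | rfl) <;> assumption⟩

theorem card_crossPairs_le (S T : Finset (Fin n)) :
    (crossPairs S T).card ≤ S.card * T.card := by
  rw [← Finset.card_product]
  refine (Finset.card_le_card (t := (S ×ˢ T).image fun x => s(x.1, x.2)) ?_).trans
    Finset.card_image_le
  intro e he
  obtain ⟨a, ha, b, hb, h⟩ := (Finset.mem_filter.1 he).2
  exact Finset.mem_image.2 ⟨(a, b), Finset.mem_product.2 ⟨ha, hb⟩, h.symm⟩

theorem deg_fromEdgeSet (S : Finset (Sym2 (Fin n))) (v : Fin n) :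
    deg (fromEdgeSet (S : Set (Sym2 (Fin n)))) v = (S ∩ starPairs v).card := by
  have h : (S ∩ starPairs v : Set (Sym2 (Fin n))) =
      (fun w => s(v, w)) '' (fromEdgeSet (S : Set (Sym2 (Fin n)))).neighborSet v := by
    rw [starPairs_eq_image]
    ext e
    simp only [Set.mem_inter_iff, Finset.coe_image, Set.mem_image, Finset.mem_coe,
      Finset.mem_erase, Finset.mem_univ, and_true, mem_neighborSet, fromEdgeSet_adj]
    constructor
    · rintro ⟨h1, w, hw, rfl⟩
      exact ⟨w, ⟨h1, Ne.symm hw⟩, rfl⟩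
    · rintro ⟨w, ⟨h1, h2⟩, rfl⟩
      exact ⟨h1, w, Ne.symm h2, rfl⟩
  rw [deg, ← Set.ncard_coe_finset, Finset.coe_inter, h,
    Set.ncard_image_of_injective _ fun _ _ h => Sym2.congr_right.1 h]

theorem eIn_fromEdgeSet {S : Finset (Sym2 (Fin n))} (hS : S ⊆ pairs n) (T : Finset (Fin n)) :
    eIn (fromEdgeSet (S : Set (Sym2 (Fin n)))) T = (S ∩ innerPairs T).card := by
  rw [eIn, edgeSet_fromEdgeSet_of_subset hS, ← Set.ncard_coe_finset]
  congr 1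
  ext e
  have := @hS e
  simp only [innerPairs, Set.mem_ofPred_eq, Finset.coe_inter, Set.mem_inter_iff, Finset.mem_coe,
    Finset.mem_filter] at *
  tauto

theorem eBtw_fromEdgeSet {S : Finset (Sym2 (Fin n))} (hS : S ⊆ pairs n) (T U : Finset (Fin n)) :
    eBtw (fromEdgeSet (S : Set (Sym2 (Fin n)))) T U = (S ∩ crossPairs T U).card := by
  rw [eBtw, edgeSet_fromEdgeSet_of_subset hS, ← Set.ncard_coe_finset]
  congr 1
  ext e
  have := @hS e
  simp only [crossPairs, Set.mem_ofPred_eq, Finset.coe_inter, Set.mem_inter_iff, Finset.mem_coe,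
    Finset.mem_filter] at *
  tauto

theorem starPairs_subset (v : Fin n) : starPairs v ⊆ pairs n := Finset.filter_subset _ _

theorem innerPairs_subset (T : Finset (Fin n)) : innerPairs T ⊆ pairs n :=
  Finset.filter_subset _ _

theorem crossPairs_subset (S T : Finset (Fin n)) : crossPairs S T ⊆ pairs n :=
  Finset.filter_subset _ _

theorem minDeg_le_deg (G : SimpleGraph (Fin n)) (v : Fin n) : minDeg G ≤ deg G v :=
  Nat.sInf_le ⟨v, rfl⟩

theorem exists_deg_eq_minDeg [NeZero n] (G : SimpleGraph (Fin n)) : ∃ v, deg G v = minDeg G :=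
  Nat.sInf_mem (Set.range_nonempty _)

theorem exists_deg_eq_maxDeg [NeZero n] (G : SimpleGraph (Fin n)) : ∃ v, deg G v = maxDeg G :=
  Nat.sSup_mem (Set.range_nonempty _) (Set.finite_range _).bddAbove

/-- A graph whose minimum degree is attained once, with a large gap to all other degrees, is
strongly 2-jumping. -/
theorem stronglyTwoJumping_of_gap [NeZero n] {G : SimpleGraph (Fin n)}
    (h : ∃ v, deg G v = minDeg G ∧
      ∀ w, w ≠ v → (minDeg G : ℝ) + 2 * Real.log n ^ 2 ≤ deg G w) :
    StronglyTwoJumping n G := by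
  obtain ⟨v, hv, hw⟩ := h
  intro T hT
  set s := (Set.toFinite T).toFinset with hs
  have hcard : T.ncard = s.card := Set.ncard_eq_toFinset_card _ _
  have hpos : 0 < s.card := by rw [← hcard]; exact (Set.ncard_pos (Set.toFinite T)).2 hT
  have hpos' : (1 : ℝ) ≤ s.card := by exact_mod_cast hpos
  have hsq : 0 ≤ Real.log n ^ 2 := sq_nonneg _
  rw [hcard, ge_iff_le, le_div_iff₀ (by linarith)]
  have hsum : (s.card : ℝ) * minDeg G + (s.card - 1) * (2 * Real.log n ^ 2) ≤
      ∑ w ∈ s, (deg G w : ℝ) := by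
    have h1 : ∑ w ∈ s, ((minDeg G : ℝ) + 2 * Real.log n ^ 2 -
        if w = v then 2 * Real.log n ^ 2 else 0) ≤ ∑ w ∈ s, (deg G w : ℝ) := by
      refine Finset.sum_le_sum fun w _ => ?_
      split_ifs with h
      · rw [h, hv]; linarith
      · linarith [hw w h]
    have h2 : ∑ w ∈ s, (if w = v then 2 * Real.log n ^ 2 else 0) ≤ 2 * Real.log n ^ 2 := by
      rw [Finset.sum_ite_eq']
      split_ifs
      · exact le_rfl
      · linarith
    rw [Finset.sum_sub_distrib, Finset.sum_const, nsmul_eq_mul] at h1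
    linarith
  refine le_trans ?_ hsum
  rcases Nat.eq_or_lt_of_le (Nat.succ_le_of_lt hpos) with h1 | h2
  · have : (s.card : ℝ) = 1 := by exact_mod_cast h1.symm
    rw [this]
    have := min_le_left ((1 : ℝ) - 1) (Real.log n ^ 2)
    linarith
  · have h2' : (2 : ℝ) ≤ s.card := by exact_mod_cast h2
    have := min_le_right ((s.card : ℝ) - 1) (Real.log n ^ 2)
    nlinarith

end RandomGraph

section TailBounds

open EDHC

theorem bernProb_abs_deviation_le {α : Type*} [DecidableEq α] {p : ℝ} (h0 : 0 ≤ p) (h1 : p ≤ 1)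
    {t : ℝ} (ht0 : 0 < t) (ht : t ≤ 1) (y : ℝ) {E F : Finset α} (hF : F ⊆ E) :
    bernProb p E (fun S => y ≤ |((S ∩ F).card : ℝ) - F.card * p|) ≤
      2 * Real.exp (3 / 4 * (F.card * p * (1 - p)) * t ^ 2 - t * y) := by
  have hU := bernProb_deviation_le h0 h1 (t := t) (by rwa [abs_of_pos ht0]) (t * y) hF
  have hL := bernProb_deviation_le h0 h1 (t := -t) (by rwa [abs_neg, abs_of_pos ht0]) (t * y) hF
  rw [neg_sq] at hL
  rw [two_mul]
  refine le_trans ?_ (add_le_add hU hL)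
  refine le_trans (bernProb_mono h0 h1 fun S _ h => ?_) (bernProb_or_le h0 h1 E _ _)
  rw [neg_mul, ← mul_neg]
  exact (le_abs.1 h).imp (mul_le_mul_of_nonneg_left · ht0.le) (mul_le_mul_of_nonneg_left · ht0.le)

theorem sum_pow_card_le {n : ℕ} {x : ℝ} (hx : 0 ≤ x) (hnx : n * x ≤ 1) :
    ∑ T ∈ (Finset.univ : Finset (Finset (Fin n))).erase ∅, x ^ T.card ≤ 2 * (n * x) := by
  have h := Finset.sum_pow_mul_eq_add_pow x 1 (Finset.univ : Finset (Fin n))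
  simp only [one_pow, mul_one, Finset.powerset_univ, Finset.card_univ, Fintype.card_fin] at h
  have h' := Finset.add_sum_erase (Finset.univ : Finset (Finset (Fin n)))
    (fun T => x ^ T.card) (Finset.mem_univ ∅)
  rw [Finset.card_empty, pow_zero, h] at h'
  have hnx0 : 0 ≤ n * x := by positivity
  have e1 : (x + 1) ^ n ≤ Real.exp (n * x) := by
    rw [Real.exp_nat_mul]
    exact pow_le_pow_left₀ (by linarith) (Real.add_one_le_exp x) n
  have e2 := exp_le_one_add_add_sq (x := n * x) (by rwa [abs_of_nonneg hnx0])
  nlinarith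

variable {n : ℕ} {p : ℝ}

theorem innerPairs_deviation_le (hn : 0 < n) (h0 : 0 < p) (h1 : p < 1)
    {T : Finset (Fin n)} (hT : T.Nonempty) :
    bernProb p (pairs n) (fun S => 2 * √(n * p * (1 - p)) * T.card ≤
      |((S ∩ innerPairs T).card : ℝ) - (innerPairs T).card * p|) ≤
      2 * (Real.exp (-(3 / 2 * n)) +
        Real.exp (-(3 / 2 * (√(n * p * (1 - p)) * T.card)))) := by
  have hq : 0 < 1 - p := by linarith
  have hn' : (0 : ℝ) < n := by exact_mod_cast hn
  have ht : (0 : ℝ) < T.card := by exact_mod_cast hT.card_pos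
  have hpos : 0 < n * p * (1 - p) := by positivity
  set σ := √(n * p * (1 - p)) with hσ
  have hσ0 : 0 < σ := Real.sqrt_pos.2 hpos
  have hσ2 : σ ^ 2 = n * p * (1 - p) := Real.sq_sqrt hpos.le
  have hN : ((innerPairs T).card : ℝ) ≤ (T.card : ℝ) ^ 2 / 2 := by
    rw [card_innerPairs, Nat.cast_choose_two]
    nlinarith
  have hv : (innerPairs T).card * p * (1 - p) ≤ (T.card : ℝ) ^ 2 / 2 * (p * (1 - p)) := by
    rw [mul_assoc]
    gcongr
  have hσt : 0 < σ * T.card := by positivity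
  rcases le_or_gt (n : ℝ) (σ * T.card) with h | h
  · have hb := bernProb_abs_deviation_le h0.le h1.le (t := n / (σ * T.card)) (by positivity)
      (div_le_one_of_le₀ h hσt.le) (2 * σ * T.card) (innerPairs_subset T)
    refine hb.trans (mul_le_mul_of_nonneg_left ?_ two_pos.le)
    refine le_trans (Real.exp_le_exp.2 ?_) (le_add_of_nonneg_right (Real.exp_pos _).le)
    have e1 : n / (σ * T.card) * (2 * σ * T.card) = 2 * n := by field_simp
    have e2 : (T.card : ℝ) ^ 2 / 2 * (p * (1 - p)) * (n / (σ * T.card)) ^ 2 = n / 2 := by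
      rw [div_pow, mul_pow, hσ2]
      field_simp
    have e3 := mul_le_mul_of_nonneg_right hv (sq_nonneg (n / (σ * T.card)))
    rw [e1]
    linarith
  · have hb := bernProb_abs_deviation_le h0.le h1.le (t := 1) one_pos le_rfl
      (2 * σ * T.card) (innerPairs_subset T)
    refine hb.trans (mul_le_mul_of_nonneg_left ?_ two_pos.le)
    refine le_trans (Real.exp_le_exp.2 ?_) (le_add_of_nonneg_left (Real.exp_pos _).le)
    have e : (T.card : ℝ) ^ 2 * (p * (1 - p)) ≤ σ * T.card := by
      refine le_of_mul_le_mul_left ?_ hn'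
      calc (n : ℝ) * ((T.card : ℝ) ^ 2 * (p * (1 - p))) = (σ * T.card) * (σ * T.card) := by
            linear_combination -(T.card : ℝ) ^ 2 * hσ2
        _ ≤ _ := mul_le_mul_of_nonneg_right h.le hσt.le
    linarith

theorem bernProb_not_isJumbled_le (hn : 0 < n) (h0 : 0 < p) (h1 : p < 1)
    (hσ : 2 * Real.log n ≤ √(n * p * (1 - p))) :
    bernProb p (pairs n) (fun S => ¬ IsJumbled (fromEdgeSet (S : Set (Sym2 (Fin n)))) p
      (2 * √(n * p * (1 - p)))) ≤ 8 * Real.exp (-Real.log n) := by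
  have hn' : (0 : ℝ) < n := by exact_mod_cast hn
  have hexp : Real.exp (-Real.log n) = (n : ℝ)⁻¹ := by rw [Real.exp_neg, Real.exp_log hn']
  set x := Real.exp (-(2 * Real.log n)) with hx
  have hnx : n * x = Real.exp (-Real.log n) := by
    nth_rw 1 [← Real.exp_log hn']
    rw [hx, ← Real.exp_add]
    congr 1
    ring
  have hn1 : (n : ℝ)⁻¹ ≤ 1 := inv_le_one_of_one_le₀ (by exact_mod_cast hn)
  calc _ ≤ bernProb p (pairs n) (fun S => ∃ T ∈ (Finset.univ : Finset (Finset (Fin n))).erase ∅,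
        2 * √(n * p * (1 - p)) * T.card ≤
          |((S ∩ innerPairs T).card : ℝ) - (innerPairs T).card * p|) := by
        refine bernProb_mono h0.le h1.le fun S hS h => ?_
        rw [IsJumbled] at h
        push Not at h
        obtain ⟨T, hT⟩ := h
        obtain ⟨T, rfl⟩ : ∃ T' : Finset (Fin n), T = T' := ⟨(Set.toFinite T).toFinset, by simp⟩
        rw [eIn_fromEdgeSet hS, Set.ncard_coe_finset, ← Nat.cast_choose_two,
          ← card_innerPairs, mul_comm p] at hT
        refine ⟨T, Finset.mem_erase.2 ⟨?_, Finset.mem_univ _⟩, hT.le⟩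
        rintro rfl
        have : innerPairs (∅ : Finset (Fin n)) = ∅ := by
          rw [← Finset.card_eq_zero, card_innerPairs]; rfl
        simp [this] at hT
    _ ≤ ∑ T ∈ (Finset.univ : Finset (Finset (Fin n))).erase ∅, 2 * (Real.exp (-(3 / 2 * n)) +
          Real.exp (-(3 / 2 * (√(n * p * (1 - p)) * T.card)))) :=
        (bernProb_exists_le h0.le h1.le _ _ _).trans (Finset.sum_le_sum fun T hT =>
          innerPairs_deviation_le hn h0 h1
            (Finset.nonempty_iff_ne_empty.2 (Finset.ne_of_mem_erase hT)))
    _ ≤ ∑ T ∈ (Finset.univ : Finset (Finset (Fin n))).erase ∅,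
          (2 * Real.exp (-(3 / 2 * n)) + 2 * x ^ T.card) := by
        refine Finset.sum_le_sum fun T _ => ?_
        rw [mul_add, hx, ← Real.exp_nat_mul]
        gcongr
        have := mul_le_mul_of_nonneg_right hσ (Nat.cast_nonneg (α := ℝ) T.card)
        have : 0 ≤ Real.log n * T.card :=
          mul_nonneg (Real.log_natCast_nonneg n) (Nat.cast_nonneg _)
        linarith
    _ ≤ 2 ^ n * (2 * Real.exp (-(3 / 2 * n))) + 2 * (2 * (n * x)) := by
        rw [Finset.sum_add_distrib, Finset.sum_const, nsmul_eq_mul,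
          ← Finset.mul_sum _ (fun T : Finset (Fin n) => x ^ T.card)]
        gcongr
        · refine (Nat.cast_le.2 (Finset.card_le_card (Finset.erase_subset _ _))).trans ?_
          simp
        · exact sum_pow_card_le (Real.exp_pos _).le (by rw [hnx, hexp]; exact hn1)
    _ ≤ _ := by
        have h2 : (2 : ℝ) ^ n ≤ Real.exp n := by
          rw [← mul_one (n : ℝ), Real.exp_nat_mul]
          exact pow_le_pow_left₀ two_pos.le (by linarith [Real.add_one_le_exp (1 : ℝ)]) n
        have h3 : Real.exp n * Real.exp (-(3 / 2 * n)) ≤ 2 * (n : ℝ)⁻¹ := by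
          rw [← Real.exp_add, show (n : ℝ) + -(3 / 2 * n) = -(n / 2) by ring, Real.exp_neg]
          have := Real.add_one_le_exp ((n : ℝ) / 2)
          rw [← div_eq_mul_inv, inv_le_comm₀ (Real.exp_pos _) (by positivity), inv_div]
          linarith
        have h4 : (2 : ℝ) ^ n * Real.exp (-(3 / 2 * n)) ≤ 2 * (n : ℝ)⁻¹ :=
          (mul_le_mul_of_nonneg_right h2 (Real.exp_pos _).le).trans h3
        rw [hnx, hexp]
        linarith

theorem bernProb_not_innerSparse_le (hn : 0 < n) (h0 : 0 < p) (h1 : p < 1) :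
    bernProb p (pairs n) (fun G => ¬ ∀ S : Set (Fin n),
      (Real.log n / ((S.ncard : ℝ) * p) ≥ 7 / 4 →
        (eIn (fromEdgeSet (G : Set (Sym2 (Fin n)))) S : ℝ) ≤ 2 * (S.ncard : ℝ) * Real.log n) ∧
      (Real.log n / ((S.ncard : ℝ) * p) ≤ 7 / 4 →
        (eIn (fromEdgeSet (G : Set (Sym2 (Fin n)))) S : ℝ) ≤ 7 * (S.ncard : ℝ) ^ 2 * p / 2)) ≤
      2 * Real.exp (-(Real.log n / 2)) := by
  have hn' : (0 : ℝ) < n := by exact_mod_cast hn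
  have hlog : 0 ≤ Real.log n := Real.log_natCast_nonneg n
  set x := Real.exp (-(3 / 2 * Real.log n)) with hx
  have hnx : n * x = Real.exp (-(Real.log n / 2)) := by
    nth_rw 1 [← Real.exp_log hn']
    rw [hx, ← Real.exp_add]
    congr 1
    ring
  rw [← hnx]
  refine le_trans ?_ (sum_pow_card_le (Real.exp_pos _).le
    (by rw [hnx]; exact Real.exp_le_one_iff.2 (by linarith)))
  calc _ ≤ bernProb p (pairs n) (fun G => ∃ T ∈ (Finset.univ : Finset (Finset (Fin n))).erase ∅,
        max (2 * (T.card : ℝ) * Real.log n) (7 * (T.card : ℝ) ^ 2 * p / 2) ≤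
          (G ∩ innerPairs T).card) := by
        refine bernProb_mono h0.le h1.le fun G hG h => ?_
        push Not at h
        obtain ⟨T, hT⟩ := h
        obtain ⟨T, rfl⟩ : ∃ T' : Finset (Fin n), T = T' := ⟨(Set.toFinite T).toFinset, by simp⟩
        rw [eIn_fromEdgeSet hG, Set.ncard_coe_finset] at hT
        rcases T.eq_empty_or_nonempty with rfl | hne
        · have : innerPairs (∅ : Finset (Fin n)) = ∅ := by
            rw [← Finset.card_eq_zero, card_innerPairs]; rfl
          simp [this] at hT
        have ht : (0 : ℝ) < T.card := by exact_mod_cast hne.card_pos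
        have htp : 0 < (T.card : ℝ) * p := by positivity
        refine ⟨T, Finset.mem_erase.2 ⟨hne.ne_empty, Finset.mem_univ _⟩, ?_⟩
        rw [ge_iff_le, le_div_iff₀ htp, div_le_iff₀ htp] at hT
        rcases le_total (7 / 4 * ((T.card : ℝ) * p)) (Real.log n) with hc | hc
        · have hc' := mul_le_mul_of_nonneg_left hc ht.le
          rw [max_eq_left (by linarith)]
          by_contra hcon
          have := hT fun _ => (not_le.1 hcon).le
          linarith [this.2, mul_le_mul_of_nonneg_left this.1 ht.le]
        · have hc' := mul_le_mul_of_nonneg_left hc ht.le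
          rw [max_eq_right (by linarith)]
          by_contra hcon
          have := hT fun h' => by linarith [mul_le_mul_of_nonneg_left h' ht.le]
          linarith
    _ ≤ ∑ T ∈ (Finset.univ : Finset (Finset (Fin n))).erase ∅, x ^ T.card := by
        refine (bernProb_exists_le h0.le h1.le _ _ _).trans (Finset.sum_le_sum fun T hT => ?_)
        refine (bernProb_large_deviation_le h0.le h1.le (innerPairs_subset T) ?_).trans ?_
        · refine le_trans ?_ (le_max_right _ _)
          have : ((innerPairs T).card : ℝ) ≤ (T.card : ℝ) ^ 2 / 2 := by
            rw [card_innerPairs, Nat.cast_choose_two]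
            nlinarith [Nat.cast_nonneg (α := ℝ) T.card]
          nlinarith
        · rw [hx, ← Real.exp_nat_mul]
          apply Real.exp_le_exp.2
          linarith [le_max_left (2 * (T.card : ℝ) * Real.log n) (7 * (T.card : ℝ) ^ 2 * p / 2)]

theorem bernProb_not_crossSparse_le (hn : 0 < n) (h0 : 0 < p) (h1 : p < 1) :
    bernProb p (pairs n) (fun G => ¬ ∀ S T : Set (Fin n), Disjoint S T →
      ((1 / (S.ncard : ℝ) + 1 / (T.ncard : ℝ)) * Real.log n / p ≥ 7 / 2 →
        (eBtw (fromEdgeSet (G : Set (Sym2 (Fin n)))) S T : ℝ) ≤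
          2 * ((S.ncard : ℝ) + (T.ncard : ℝ)) * Real.log n) ∧
      ((1 / (S.ncard : ℝ) + 1 / (T.ncard : ℝ)) * Real.log n / p ≤ 7 / 2 →
        (eBtw (fromEdgeSet (G : Set (Sym2 (Fin n)))) S T : ℝ) ≤
          7 * (S.ncard : ℝ) * (T.ncard : ℝ) * p)) ≤
      4 * Real.exp (-Real.log n) := by
  have hn' : (0 : ℝ) < n := by exact_mod_cast hn
  have hlog : 0 ≤ Real.log n := Real.log_natCast_nonneg n
  set x := Real.exp (-(3 / 2 * Real.log n)) with hx
  have hnx : n * x = Real.exp (-(Real.log n / 2)) := by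
    nth_rw 1 [← Real.exp_log hn']
    rw [hx, ← Real.exp_add]
    congr 1
    ring
  have hx0 : 0 < x := Real.exp_pos _
  set P := (Finset.univ : Finset (Finset (Fin n))).erase ∅ with hP
  have hsum : ∑ T ∈ P, x ^ T.card ≤ 2 * (n * x) := sum_pow_card_le hx0.le
    (by rw [hnx]; exact Real.exp_le_one_iff.2 (by linarith))
  have hsq : (2 * (n * x)) * (2 * (n * x)) = 4 * Real.exp (-Real.log n) := by
    rw [hnx, show -Real.log n = -(Real.log n / 2) + -(Real.log n / 2) by ring, Real.exp_add]
    ring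
  calc _ ≤ bernProb p (pairs n) (fun G => ∃ A ∈ P ×ˢ P,
        max (2 * ((A.1.card : ℝ) + A.2.card) * Real.log n) (7 * (A.1.card : ℝ) * A.2.card * p) ≤
          (G ∩ crossPairs A.1 A.2).card) := by
        refine bernProb_mono h0.le h1.le fun G hG h => ?_
        push Not at h
        obtain ⟨S, T, -, hT⟩ := h
        obtain ⟨S, rfl⟩ : ∃ S' : Finset (Fin n), S = S' := ⟨(Set.toFinite S).toFinset, by simp⟩
        obtain ⟨T, rfl⟩ : ∃ T' : Finset (Fin n), T = T' := ⟨(Set.toFinite T).toFinset, by simp⟩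
        rw [eBtw_fromEdgeSet hG, Set.ncard_coe_finset, Set.ncard_coe_finset] at hT
        rcases S.eq_empty_or_nonempty with rfl | hS
        · have : crossPairs (∅ : Finset (Fin n)) T = ∅ := by simp [crossPairs]
          have h2 : 0 ≤ 2 * (T.card : ℝ) * Real.log n := by positivity
          simp only [this, Finset.inter_empty, Finset.card_empty, CharP.cast_eq_zero, zero_add,
            mul_zero, zero_mul, lt_irrefl, and_false] at hT
          exact (hT fun _ => h2).elim
        rcases T.eq_empty_or_nonempty with rfl | hne
        · have : crossPairs S (∅ : Finset (Fin n)) = ∅ := by simp [crossPairs]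
          have h2 : 0 ≤ 2 * (S.card : ℝ) * Real.log n := by positivity
          simp only [this, Finset.inter_empty, Finset.card_empty, CharP.cast_eq_zero, add_zero,
            mul_zero, zero_mul, lt_irrefl, and_false] at hT
          exact (hT fun _ => h2).elim
        have hs : (0 : ℝ) < S.card := by exact_mod_cast hS.card_pos
        have ht : (0 : ℝ) < T.card := by exact_mod_cast hne.card_pos
        have hstp : 0 < (S.card : ℝ) * T.card * p := by positivity
        refine ⟨(S, T), Finset.mem_product.2 ⟨Finset.mem_erase.2 ⟨hS.ne_empty, Finset.mem_univ _⟩,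
          Finset.mem_erase.2 ⟨hne.ne_empty, Finset.mem_univ _⟩⟩, ?_⟩
        have e : (1 / (S.card : ℝ) + 1 / (T.card : ℝ)) * Real.log n / p =
            ((S.card : ℝ) + T.card) * Real.log n / (S.card * T.card * p) := by
          field_simp
          ring
        rw [e, ge_iff_le, le_div_iff₀ hstp, div_le_iff₀ hstp] at hT
        dsimp only
        rcases le_total (7 / 2 * ((S.card : ℝ) * T.card * p))
          (((S.card : ℝ) + T.card) * Real.log n) with hc | hc
        · rw [max_eq_left (by linarith)]
          by_contra hcon
          have := hT fun _ => (not_le.1 hcon).le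
          linarith
        · rw [max_eq_right (by linarith)]
          by_contra hcon
          have := hT fun _ => by linarith
          linarith
    _ ≤ ∑ A ∈ P ×ˢ P, x ^ A.1.card * x ^ A.2.card := by
        refine (bernProb_exists_le h0.le h1.le _ _ _).trans (Finset.sum_le_sum fun A hA => ?_)
        refine (bernProb_large_deviation_le h0.le h1.le (crossPairs_subset _ _) ?_).trans ?_
        · refine le_trans ?_ (le_max_right _ _)
          have : ((crossPairs A.1 A.2).card : ℝ) ≤ (A.1.card : ℝ) * A.2.card := by
            exact_mod_cast card_crossPairs_le A.1 A.2
          nlinarith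
        · rw [hx, ← Real.exp_nat_mul, ← Real.exp_nat_mul, ← Real.exp_add]
          apply Real.exp_le_exp.2
          linarith [le_max_left (2 * ((A.1.card : ℝ) + A.2.card) * Real.log n)
            (7 * (A.1.card : ℝ) * A.2.card * p)]
    _ = (∑ T ∈ P, x ^ T.card) * ∑ T ∈ P, x ^ T.card := by
        rw [Finset.sum_product, Finset.sum_mul_sum]
    _ ≤ _ := by
        rw [← hsq]
        have : 0 ≤ ∑ T ∈ P, x ^ T.card := Finset.sum_nonneg fun T _ => by positivity
        exact mul_le_mul hsum hsum this (by positivity)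

end TailBounds

section Degrees

open EDHC

variable {n : ℕ} {p : ℝ}

theorem bernProb_exists_degree_deviation_le (hn : 1 < n) (h0 : 0 < p) (h1 : p < 1)
    (hnp : Real.log n ≤ n * p) :
    bernProb p (pairs n) (fun S => ∃ v ∈ (Finset.univ : Finset (Fin n)),
      2 * √(n * p * Real.log n) < |((S ∩ starPairs v).card : ℝ) - n * p|) ≤
      2 * Real.exp (1 - Real.log n / 4) := by
  have hn' : (0 : ℝ) < n := by positivity
  have hl : 0 < Real.log n := Real.log_pos (by exact_mod_cast hn)
  have hq : 0 < 1 - p := by linarith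
  have hnp0 : 0 < n * p := by positivity
  set t := √(Real.log n / (n * p)) with ht
  have ht0 : 0 < t := Real.sqrt_pos.2 (by positivity)
  have ht2 : t ^ 2 = Real.log n / (n * p) := Real.sq_sqrt (by positivity)
  have ht1 : t ≤ 1 := by
    rw [ht, Real.sqrt_le_one]
    exact div_le_one_of_le₀ hnp hnp0.le
  have htD : t * √(n * p * Real.log n) = Real.log n := by
    rw [ht, ← Real.sqrt_mul (by positivity), div_mul_eq_mul_div,
      show Real.log n * (n * p * Real.log n) = (n * p) * Real.log n ^ 2 by ring,
      mul_div_cancel_left₀ _ hnp0.ne', Real.sqrt_sq hl.le]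
  have hstar : ∀ v : Fin n, bernProb p (pairs n) (fun S =>
      2 * √(n * p * Real.log n) < |((S ∩ starPairs v).card : ℝ) - n * p|) ≤
        2 * Real.exp (1 - 5 / 4 * Real.log n) := by
    intro v
    have hN : ((starPairs v).card : ℝ) = n - 1 := by
      rw [card_starPairs, Nat.cast_sub hn.le, Nat.cast_one]
    calc _ ≤ bernProb p (pairs n) (fun S => 2 * √(n * p * Real.log n) - 1 ≤
          |((S ∩ starPairs v).card : ℝ) - (starPairs v).card * p|) := by
          refine bernProb_mono h0.le h1.le fun S _ h => ?_
          rw [hN]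
          have := abs_sub_abs_le_abs_sub (((S ∩ starPairs v).card : ℝ) - n * p)
            (((S ∩ starPairs v).card : ℝ) - (n - 1) * p)
          have e : ((S ∩ starPairs v).card : ℝ) - n * p -
            (((S ∩ starPairs v).card : ℝ) - (n - 1) * p) = -p := by ring
          rw [e, abs_neg, abs_of_pos h0] at this
          linarith
      _ ≤ _ := by
          refine (bernProb_abs_deviation_le h0.le h1.le ht0 ht1 _ (starPairs_subset v)).trans
            (mul_le_mul_of_nonneg_left (Real.exp_le_exp.2 ?_) two_pos.le)
          have e1 : (starPairs v).card * p * (1 - p) * t ^ 2 ≤ Real.log n := by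
            have : (starPairs v).card * p * (1 - p) ≤ n * p := by
              rw [hN]
              nlinarith
            refine (mul_le_mul_of_nonneg_right this (sq_nonneg t)).trans ?_
            rw [ht2, mul_div_cancel₀ _ hnp0.ne']
          nlinarith
  calc _ ≤ ∑ v : Fin n, 2 * Real.exp (1 - 5 / 4 * Real.log n) :=
        (bernProb_exists_le h0.le h1.le _ _ _).trans (Finset.sum_le_sum fun v _ => hstar v)
    _ = _ := by
        rw [Finset.sum_const, Finset.card_univ, Fintype.card_fin, nsmul_eq_mul]
        nth_rw 1 [← Real.exp_log hn']
        rw [mul_left_comm, ← Real.exp_add]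
        congr 2
        ring

theorem bernProb_minDeg_gt_le [NeZero n] (h0 : 0 < p) (h1 : p < 1)
    {m : ℕ} (hm : 2 * m ≤ n) (hσ : 1000 ≤ √(n * p * (1 - p))) (hmσ : m ≤ √(n * p * (1 - p)))
    {c : ℝ} (hc : c ≤ 1 / 2 * Real.exp (-171380)) :
    bernProb p (pairs n) (fun S => n * p - 200 * √(n * p * (1 - p)) <
      minDeg (fromEdgeSet (S : Set (Sym2 (Fin n))))) ≤
      Real.exp (-(c * m)) := by
  have hq : 0 < 1 - p := by linarith
  set σ := √(n * p * (1 - p)) with hσd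
  have hσ2 : σ ^ 2 = n * p * (1 - p) := Real.sq_sqrt (by positivity)
  obtain ⟨A, -, hA⟩ := Finset.exists_subset_card_eq
    (s := (Finset.univ : Finset (Fin n))) (n := m) (by rw [Finset.card_univ, Fintype.card_fin]; omega)
  set F : Fin n → Finset (Sym2 (Fin n)) := fun v => Aᶜ.image (fun w => s(v, w)) with hF
  have hFc : ∀ v, (F v).card = n - m := fun v => by
    rw [hF]
    dsimp only
    rw [card_image_mk, Finset.card_compl, hA, Fintype.card_fin]
  have hsub : ∀ v ∈ A, F v ⊆ pairs n := by
    intro v hv e he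
    obtain ⟨w, hw, rfl⟩ := Finset.mem_image.1 he
    rw [mem_pairs, Sym2.mk_isDiag_iff]
    rintro rfl
    exact Finset.mem_compl.1 hw hv
  have hdis : ∀ u ∈ A, ∀ v ∈ A, u ≠ v → Disjoint (F u) (F v) := by
    intro u hu v hv huv
    rw [Finset.disjoint_left]
    intro e he he'
    obtain ⟨w, hw, rfl⟩ := Finset.mem_image.1 he
    obtain ⟨w', hw', h⟩ := Finset.mem_image.1 he'
    rcases Sym2.eq_iff.1 h with ⟨h2, -⟩ | ⟨-, h2⟩
    · exact huv h2.symm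
    · exact Finset.mem_compl.1 hw' (h2 ▸ hu)
  set y := n * p - 201 * σ with hy
  have hle : ∀ v ∈ A, bernExp p (F v) (fun S => if (S.card : ℝ) ≤ y then 0 else 1) ≤
      Real.exp (-c) := by
    intro v _
    have h := hc.trans (bernProb_card_le_ge h0 h1 (E := F v) (n := n) (by rw [hFc]; omega)
      (by rw [hFc]; omega) hσ hσ2)
    have hadd : bernExp p (F v) (fun S => if (S.card : ℝ) ≤ y then 0 else 1) +
        bernProb p (F v) (fun S => (S.card : ℝ) ≤ y) = 1 := by
      rw [bernProb, ← bernExp_add]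
      refine (bernExp_congr fun S _ => ?_).trans (bernExp_const p 1 (F v))
      split_ifs <;> norm_num
    have := Real.add_one_le_exp (-c)
    linarith
  calc _ ≤ bernExp p (pairs n) (fun S => ∏ v ∈ A,
        (fun k : ℕ => if (k : ℝ) ≤ y then (0 : ℝ) else 1) (S ∩ F v).card) := by
        refine bernExp_mono h0.le h1.le fun S _ => ?_
        split_ifs with h
        · rw [Finset.prod_eq_one]
          intro v _
          dsimp only
          rw [if_neg]
          intro hcon
          have hd : (minDeg (fromEdgeSet (S : Set (Sym2 (Fin n)))) : ℝ) ≤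
              (S ∩ F v).card + m := by
            have hc : (S ∩ starPairs v).card ≤ (S ∩ F v).card + m := by
              rw [← hA, ← card_image_mk v A]
              refine (Finset.card_le_card ?_).trans (Finset.card_union_le _ _)
              intro e he
              rw [Finset.mem_inter, starPairs_eq_image] at he
              obtain ⟨w, -, rfl⟩ := Finset.mem_image.1 he.2
              by_cases hw : w ∈ A
              · exact Finset.mem_union_right _ (Finset.mem_image_of_mem _ hw)
              · exact Finset.mem_union_left _ (Finset.mem_inter.2 ⟨he.1,
                  Finset.mem_image_of_mem _ (Finset.mem_compl.2 hw)⟩)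
            have := (minDeg_le_deg (fromEdgeSet (S : Set (Sym2 (Fin n)))) v).trans
              ((deg_fromEdgeSet S v).le.trans hc)
            exact_mod_cast this
          linarith
        · exact Finset.prod_nonneg fun v _ => by dsimp only; split_ifs <;> norm_num
    _ = ∏ v ∈ A, bernExp p (F v) (fun S => if (S.card : ℝ) ≤ y then 0 else 1) :=
        bernExp_prod_card_inter p A (pairs n) F hsub hdis
          (fun k : ℕ => if (k : ℝ) ≤ y then (0 : ℝ) else 1)
    _ ≤ ∏ v ∈ A, Real.exp (-c) := by
        refine Finset.prod_le_prod (fun v _ => ?_) hle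
        exact (bernExp_const p 0 (F v)).symm.le.trans
          (bernExp_mono h0.le h1.le fun S _ => by split_ifs <;> norm_num)
    _ = _ := by
        rw [Finset.prod_const, hA, ← Real.exp_nat_mul]
        congr 1
        ring

/-- The least degree of a vertex other than `v`, not counting edges at `v`. -/
noncomputable def minDegAvoiding (v : Fin n) (S : Finset (Sym2 (Fin n))) : ℕ :=
  sInf ((fun w => ((S \ starPairs v) ∩ starPairs w).card) '' {v}ᶜ)

theorem minDegAvoiding_le {v w : Fin n} (h : w ≠ v) (S : Finset (Sym2 (Fin n))) :
    minDegAvoiding v S ≤ (S ∩ starPairs w).card :=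
  (Nat.sInf_le (Set.mem_image_of_mem _ (show w ∈ ({v}ᶜ : Set (Fin n)) from h))).trans
    (Finset.card_le_card (Finset.inter_subset_inter_right Finset.sdiff_subset))

theorem exists_card_inter_starPairs_le (hn : 1 < n) (v : Fin n) (S : Finset (Sym2 (Fin n))) :
    ∃ w, (S ∩ starPairs w).card ≤ minDegAvoiding v S + 1 := by
  have : Nontrivial (Fin n) := Fin.nontrivial_iff_two_le.2 hn
  obtain ⟨w₀, hw₀⟩ := exists_ne v
  obtain ⟨w, hw, h⟩ := Nat.sInf_mem
    ((show ({v}ᶜ : Set (Fin n)).Nonempty from ⟨w₀, hw₀⟩).image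
      fun w => ((S \ starPairs v) ∩ starPairs w).card)
  refine ⟨w, ?_⟩
  rw [minDegAvoiding, ← h]
  refine (Finset.card_le_card (t := insert s(v, w) ((S \ starPairs v) ∩ starPairs w)) ?_).trans
    (Finset.card_insert_le _ _)
  intro e he
  simp only [starPairs, Finset.mem_inter, Finset.mem_filter, Finset.mem_insert,
    Finset.mem_sdiff] at he ⊢
  by_cases hv : v ∈ e
  · exact Or.inl ((Sym2.mem_and_mem_iff (Ne.symm hw)).1 ⟨hv, he.2.2⟩)
  · tauto

theorem sum_ite_lt_minDegAvoiding_le (S : Finset (Sym2 (Fin n))) :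
    ∑ v : Fin n, (if (S ∩ starPairs v).card < minDegAvoiding v S then (1 : ℝ) else 0) ≤ 1 := by
  rw [← Finset.sum_filter, Finset.sum_const, nsmul_eq_mul, mul_one, ← Nat.cast_one, Nat.cast_le,
    Finset.card_le_one]
  intro a ha b hb
  by_contra hab
  have h1 := (Finset.mem_filter.1 ha).2.trans_le (minDegAvoiding_le (Ne.symm hab) S)
  have h2 := (Finset.mem_filter.1 hb).2.trans_le (minDegAvoiding_le hab S)
  omega

/-- A window estimate for the distribution of a single degree gives an estimate for the
probability that the degree of `v` is close to the minimum degree of the other vertices. -/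
theorem bernProb_degree_near_minDegAvoiding_le (h0 : 0 < p) (h1 : p < 1) {θ C : ℝ}
    {L : ℕ} (hC : 0 ≤ C)
    (hwin : ∀ M : ℕ, θ ≤ M → L ≤ M ∧
      ∑ k ∈ Finset.Ico (M - L) (M - L + (L + 2)), binomPmf p (n - 1) k ≤
        C * ∑ k ∈ Finset.range (M - L), binomPmf p (n - 1) k) (v : Fin n) :
    bernProb p (pairs n) (fun S => θ ≤ minDegAvoiding v S ∧
      minDegAvoiding v S ≤ (S ∩ starPairs v).card + L ∧
      (S ∩ starPairs v).card ≤ minDegAvoiding v S + 1) ≤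
      C * bernProb p (pairs n) (fun S => (S ∩ starPairs v).card < minDegAvoiding v S) := by
  rw [← Finset.sdiff_union_of_subset (starPairs_subset v), bernProb, bernProb,
    bernExp_union p Finset.sdiff_disjoint, bernExp_union p Finset.sdiff_disjoint,
    ← bernExp_const_mul]
  refine bernExp_mono h0.le h1.le fun T hT => ?_
  have e1 : ∀ S ⊆ starPairs v, (T ∪ S) ∩ starPairs v = S := fun S hS => by
    ext e
    have a1 := @hT e
    have a2 := @hS e
    simp only [Finset.mem_inter, Finset.mem_union, Finset.mem_sdiff] at *
    tauto
  have e2 : ∀ S ⊆ starPairs v, minDegAvoiding v (T ∪ S) = minDegAvoiding v T := fun S hS => by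
    have : (T ∪ S) \ starPairs v = T \ starPairs v := by
      ext e
      have a2 := @hS e
      simp only [Finset.mem_union, Finset.mem_sdiff] at *
      tauto
    rw [minDegAvoiding, minDegAvoiding, this]
  set M := minDegAvoiding v T with hM
  by_cases hθ : θ ≤ M
  · obtain ⟨hLM, hw⟩ := hwin M hθ
    rw [← card_starPairs v, ← bernProb_card_mem, ← bernProb_card_mem] at hw
    refine le_trans (bernExp_mono h0.le h1.le fun S hS => ?_) (hw.trans
      (mul_le_mul_of_nonneg_left (bernExp_mono h0.le h1.le fun S hS => ?_) hC))
    · rw [e1 S hS, e2 S hS]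
      split_ifs with c1 c2
      · exact le_rfl
      · refine absurd (Finset.mem_Ico.2 ?_) c2
        omega
      · norm_num
      · exact le_rfl
    · rw [e1 S hS, e2 S hS]
      split_ifs with c1 c2
      · exact le_rfl
      · have := Finset.mem_range.1 c1
        omega
      · norm_num
      · exact le_rfl
  · have hz : bernExp p (starPairs v) (fun _ => 0) = 0 := bernExp_const p 0 _
    refine le_trans (bernExp_mono h0.le h1.le fun S hS => ?_) (hz.le.trans
      (mul_nonneg hC (hz.symm.le.trans (bernExp_mono h0.le h1.le fun S hS => ?_))))
    · rw [if_neg]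
      rw [e2 S hS]
      tauto
    · split_ifs <;> norm_num

theorem bernProb_not_stronglyTwoJumping_le (hn : 1 < n) (h0 : 0 < p) (h1 : p < 1) {θ C : ℝ}
    {L : ℕ} (hC : 0 ≤ C) (hL : 2 * Real.log n ^ 2 ≤ L)
    (hwin : ∀ M : ℕ, θ - 1 ≤ M → L ≤ M ∧
      ∑ k ∈ Finset.Ico (M - L) (M - L + (L + 2)), binomPmf p (n - 1) k ≤
        C * ∑ k ∈ Finset.range (M - L), binomPmf p (n - 1) k) :
    bernProb p (pairs n) (fun S => θ ≤ minDeg (fromEdgeSet (S : Set (Sym2 (Fin n)))) ∧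
      ¬ StronglyTwoJumping n (fromEdgeSet (S : Set (Sym2 (Fin n))))) ≤ C := by
  have : NeZero n := ⟨by omega⟩
  calc _ ≤ bernProb p (pairs n) (fun S => ∃ v ∈ (Finset.univ : Finset (Fin n)),
        θ - 1 ≤ minDegAvoiding v S ∧ minDegAvoiding v S ≤ (S ∩ starPairs v).card + L ∧
          (S ∩ starPairs v).card ≤ minDegAvoiding v S + 1) := by
        refine bernProb_mono h0.le h1.le fun S _ h => ?_
        obtain ⟨hθ, hS⟩ := h
        set G := fromEdgeSet (S : Set (Sym2 (Fin n))) with hG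
        obtain ⟨v, hv⟩ := exists_deg_eq_minDeg G
        obtain ⟨w, hwv, hw⟩ : ∃ w, w ≠ v ∧ deg G w < minDeg G + L := by
          by_contra hcon
          push Not at hcon
          refine hS (stronglyTwoJumping_of_gap ⟨v, hv, fun w hw => ?_⟩)
          have : ((minDeg G + L : ℕ) : ℝ) ≤ deg G w := by exact_mod_cast hcon w hw
          push_cast at this
          linarith
        obtain ⟨w', hw'⟩ := exists_card_inter_starPairs_le hn v S
        have hmin := minDeg_le_deg G w'
        rw [hG, deg_fromEdgeSet, ← hG] at hmin hw hv
        have hwM := minDegAvoiding_le hwv S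
        refine ⟨v, Finset.mem_univ v, ?_, by omega, by omega⟩
        have : (minDeg G : ℝ) ≤ minDegAvoiding v S + 1 := by exact_mod_cast hmin.trans hw'
        linarith
    _ ≤ ∑ v : Fin n, C *
          bernProb p (pairs n) (fun S => (S ∩ starPairs v).card < minDegAvoiding v S) :=
        (bernProb_exists_le h0.le h1.le _ _ _).trans (Finset.sum_le_sum fun v _ =>
          bernProb_degree_near_minDegAvoiding_le h0 h1 hC hwin v)
    _ ≤ C * 1 := by
        rw [← Finset.mul_sum]
        refine mul_le_mul_of_nonneg_left ?_ hC
        simp only [bernProb]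
        rw [← bernExp_sum]
        refine (bernExp_mono h0.le h1.le fun S _ => ?_).trans (bernExp_const p 1 (pairs n)).le
        convert sum_ite_lt_minDegAvoiding_le S
    _ = C := mul_one C

set_option maxHeartbeats 1000000 in
/-- The window estimate holds for the window lengths and thresholds needed for `G(n,p)`. -/
theorem binom_window_le_of_large (hn : 1 < n) (h0 : 0 < p) (h1 : p < 1) {l : ℝ} (hl : 4 ≤ l)
    (hp : 576 * l ^ 7 ≤ n * p * (1 - p) ^ 2) (M : ℕ)
    (hM : n * p - 2 * √(n * p * l) - 1 ≤ M) :
    ⌈2 * l ^ 2⌉₊ ≤ M ∧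
      ∑ k ∈ Finset.Ico (M - ⌈2 * l ^ 2⌉₊) (M - ⌈2 * l ^ 2⌉₊ + (⌈2 * l ^ 2⌉₊ + 2)),
          binomPmf p (n - 1) k ≤
        5 / l * ∑ k ∈ Finset.range (M - ⌈2 * l ^ 2⌉₊), binomPmf p (n - 1) k := by
  have hq : 0 < 1 - p := by linarith
  have hn' : (0 : ℝ) < n := by positivity
  have hnp : 0 < n * p := by positivity
  have hl0 : 0 < l := by linarith
  set L := ⌈2 * l ^ 2⌉₊ with hL
  set J := ⌈l / 4⌉₊ with hJ
  have hL1 : (L : ℝ) ≤ 2 * l ^ 2 + 1 := (Nat.ceil_lt_add_one (by positivity)).le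
  have hJ0 : l / 4 ≤ J := Nat.le_ceil _
  have hJ1 : (J : ℝ) ≤ l / 2 := by
    have := Nat.ceil_lt_add_one (a := l / 4) (by positivity)
    linarith
  have hW : ((L + 2 : ℕ) : ℝ) ≤ 3 * l ^ 2 := by push_cast; nlinarith
  have hWJ : ((L + 2 : ℕ) : ℝ) * J ≤ 3 / 2 * l ^ 3 := by
    calc ((L + 2 : ℕ) : ℝ) * J ≤ 3 * l ^ 2 * (l / 2) := by gcongr
      _ = _ := by ring
  have hWJ0 : (0 : ℝ) ≤ ((L + 2 : ℕ) : ℝ) * J := by positivity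
  set u := √(n * p * l) with hu
  have hu0 : 0 < u := Real.sqrt_pos.2 (by positivity)
  have hu2 : u ^ 2 = n * p * l := Real.sq_sqrt (by positivity)
  have hnpq : 576 * l ^ 7 ≤ n * p := by
    refine hp.trans ?_
    have : (1 - p) ^ 2 ≤ 1 := pow_le_one₀ hq.le (by linarith)
    nlinarith
  have hul : 24 * l ^ 4 ≤ u := by
    refine (sq_le_sq₀ (by positivity) hu0.le).1 ?_
    rw [hu2]
    nlinarith
  have hl34 : 4 * l ^ 3 ≤ l ^ 4 := by nlinarith [pow_pos hl0 3]
  have hl23 : 4 * l ^ 2 ≤ l ^ 3 := by nlinarith [pow_pos hl0 2]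
  have hl12 : 4 * l ≤ l ^ 2 := by nlinarith
  have hv : 24 * l ^ 3 * u ≤ n * p * (1 - p) := by
    refine (sq_le_sq₀ (by positivity) (by positivity)).1 ?_
    calc (24 * l ^ 3 * u) ^ 2 = n * p * (576 * l ^ 7) := by
          rw [mul_pow, hu2]; ring
      _ ≤ n * p * (n * p * (1 - p) ^ 2) := mul_le_mul_of_nonneg_left hp hnp.le
      _ = _ := by ring
  have hvnp : n * p * (1 - p) ≤ n * p := by nlinarith
  set D := 2 * u + 1 + L + ((L + 2 : ℕ) : ℝ) * J with hD
  have hD3 : D ≤ 3 * u := by linarith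
  have hD0 : 0 ≤ D := by positivity
  have hl3u : 64 * u ≤ l ^ 3 * u := by
    refine mul_le_mul_of_nonneg_right ?_ hu0.le
    linarith
  have hLM : (L : ℝ) ≤ M := by linarith
  have hLM' : L ≤ M := by exact_mod_cast hLM
  have hcast : ((n - 1 : ℕ) : ℝ) + 1 = n := by
    rw [Nat.cast_sub hn.le]; push_cast; ring
  refine ⟨hLM', ?_⟩
  have key := binom_window_le h0 h1 hD0 (N := n - 1) (a := M - L) (W := L + 2) (J := J)
    (by rw [hcast, Nat.cast_sub hLM']; linarith) (by rw [hcast]; linarith)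
    (by
      rw [hcast]
      calc ((L + 2 : ℕ) : ℝ) * J * D ≤ 3 / 2 * l ^ 3 * (3 * u) := by gcongr
        _ ≤ _ := by nlinarith)
    (Nat.mul_pos (by omega) (by
      have : (0 : ℝ) < J := by linarith
      exact_mod_cast this))
  set P := ∑ k ∈ Finset.Ico (M - L) (M - L + (L + 2)), binomPmf p (n - 1) k with hP
  have hP0 : 0 ≤ P := Finset.sum_nonneg fun k _ => binomPmf_nonneg h0.le h1.le _ _
  rw [div_mul_eq_mul_div, le_div_iff₀ hl0]
  nlinarith

end Degrees

section Pseudorandom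

open EDHC

variable {n : ℕ} {p : ℝ}

theorem gnpProb_not_isPseudorandom_le (h0 : 0 < p) (h1 : p < 1) (hl : 4 ≤ Real.log n)
    (hp : 576 * Real.log n ^ 7 ≤ n * p * (1 - p) ^ 2) {c : ℝ}
    (hc0 : 0 ≤ c) (hc : c ≤ 1 / 2 * Real.exp (-171380)) :
    gnpProb n p (fun G => ¬ IsPseudorandom n G p) ≤
      8 * Real.exp (-Real.log n) + 4 * Real.exp (-Real.log n) + 2 * Real.exp (-(Real.log n / 2)) +
        2 * Real.exp (1 - Real.log n / 4) + Real.exp (-(c * Real.log n)) + 5 / Real.log n := by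
  have hn0 : n ≠ 0 := by
    rintro rfl
    norm_num at hl
  have hn1 : n ≠ 1 := by
    rintro rfl
    norm_num at hl
  have hn : 1 < n := by omega
  have : NeZero n := ⟨hn0⟩
  have hq : 0 < 1 - p := by linarith
  set l := Real.log n with hl_def
  have hl0 : 0 < l := by linarith
  have hnp : 0 < n * p := by positivity
  have hl6 : l ^ 6 ≤ l ^ 7 := pow_le_pow_right₀ (by linarith) (by norm_num)
  have hl1 : l ≤ l ^ 7 := le_self_pow₀ (by linarith) (by norm_num)
  have hnpq : n * p * (1 - p) ^ 2 ≤ n * p * (1 - p) :=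
    mul_le_mul_of_nonneg_left (by nlinarith) hnp.le
  have hnpq' : n * p * (1 - p) ≤ n * p := by nlinarith
  have hnpn : n * p ≤ n := by nlinarith
  have hσ : 24 * l ^ 3 ≤ √(n * p * (1 - p)) := by
    refine Real.le_sqrt_of_sq_le ?_
    calc (24 * l ^ 3) ^ 2 = 576 * l ^ 6 := by ring
      _ ≤ n * p * (1 - p) := by linarith
  have hl3 : 16 * l ≤ l ^ 3 := by nlinarith [mul_nonneg hl0.le (sub_nonneg.2 hl)]
  have hm := Nat.ceil_lt_add_one hl0.le
  have hmin := bernProb_minDeg_gt_le (m := ⌈l⌉₊) h0 h1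
    (by
      have : ((2 * ⌈l⌉₊ : ℕ) : ℝ) ≤ n := by
        push_cast
        linarith
      exact_mod_cast this) (by linarith) (by linarith) hc
  have hexp : Real.exp (-(c * ⌈l⌉₊)) ≤ Real.exp (-(c * l)) :=
    Real.exp_le_exp.2 (neg_le_neg (mul_le_mul_of_nonneg_left (Nat.le_ceil l) hc0))
  have hjum := bernProb_not_isJumbled_le (n := n) (by omega) h0 h1 (by linarith)
  have hcross := bernProb_not_crossSparse_le (n := n) (by omega) h0 h1
  have hinner := bernProb_not_innerSparse_le (n := n) (by omega) h0 h1
  have hdeg := bernProb_exists_degree_deviation_le hn h0 h1 (by linarith)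
  have hjump := bernProb_not_stronglyTwoJumping_le hn h0 h1
    (θ := n * p - 2 * √(n * p * l)) (C := 5 / l) (by positivity) (Nat.le_ceil _)
    (binom_window_le_of_large hn h0 h1 hl hp)
  rw [gnpProb_eq]
  refine (bernProb_mono h0.le h1.le fun S _ h => ?_).trans
    (bernProb_or_le_add h0.le h1.le (bernProb_or_le_add h0.le h1.le (bernProb_or_le_add h0.le h1.le
      (bernProb_or_le_add h0.le h1.le (bernProb_or_le_add h0.le h1.le
        hjum hcross) hinner) hdeg) (hmin.trans hexp)) hjump)
  by_contra hcon
  simp only [not_or, not_not, not_exists, not_and, Finset.mem_univ, true_implies, not_lt] at hcon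
  obtain ⟨⟨⟨⟨⟨c1, c2⟩, c3⟩, c4⟩, c5⟩, c6⟩ := hcon
  set G := fromEdgeSet (S : Set (Sym2 (Fin n))) with hG
  obtain ⟨v, hv⟩ := exists_deg_eq_minDeg G
  obtain ⟨w, hw⟩ := exists_deg_eq_maxDeg G
  have hv' := abs_le.1 (c4 v)
  have hw' := abs_le.1 (c4 w)
  rw [← deg_fromEdgeSet, ← hG] at hv' hw'
  rw [hv] at hv'
  rw [hw] at hw'
  exact h ⟨c1, c2, c3, ⟨by linarith, c5, by linarith⟩, c6 (by linarith)⟩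

theorem eventually_pseudorandom_error_le {c : ℝ} (hc0 : 0 < c) (hc : c ≤ 1 / 4) :
    ∀ᶠ l : ℝ in Filter.atTop,
      8 * Real.exp (-l) + 4 * Real.exp (-l) + 2 * Real.exp (-(l / 2)) + 2 * Real.exp (1 - l / 4) +
        Real.exp (-(c * l)) + 5 / l ≤ 11 / l := by
  have h := (tendsto_rpow_mul_exp_neg_mul_atTop_nhds_zero 1 c hc0).eventually
    (ge_mem_nhds (show (0 : ℝ) < 6 / 21 by norm_num))
  filter_upwards [h, Filter.eventually_gt_atTop 0] with l h hl
  rw [Real.rpow_one, neg_mul] at h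
  have hcl : c * l ≤ l / 4 := by nlinarith
  have e1 : Real.exp (-l) ≤ Real.exp (-(c * l)) := Real.exp_le_exp.2 (by linarith)
  have e2 : Real.exp (-(l / 2)) ≤ Real.exp (-(c * l)) := Real.exp_le_exp.2 (by linarith)
  have e3 : Real.exp (1 - l / 4) ≤ 3 * Real.exp (-(c * l)) := by
    rw [sub_eq_add_neg, Real.exp_add]
    exact mul_le_mul (by linarith [Real.exp_one_lt_d9]) (Real.exp_le_exp.2 (by linarith))
      (Real.exp_pos _).le (by norm_num)
  have e4 : Real.exp (-(c * l)) * 21 ≤ 6 / l := by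
    rw [le_div_iff₀ hl]
    linarith
  have e5 : 11 / l = 6 / l + 5 / l := by ring
  linarith

theorem le_mul_one_sub_sq (hn : 0 < n) {l : ℝ} (hl : 0 ≤ l)
    (hp : 48 ^ 2 * l ^ 7 / n ≤ p)
    (hp' : p ≤ 1 - 36 * (n : ℝ) ^ (-(1 / 2 : ℝ)) * l ^ (7 / 2 : ℝ)) :
    576 * l ^ 7 ≤ n * p * (1 - p) ^ 2 := by
  have hn' : (0 : ℝ) < n := by exact_mod_cast hn
  rw [div_le_iff₀ hn'] at hp
  have ha : ((n : ℝ) ^ (-(1 / 2 : ℝ))) ^ 2 = (n : ℝ)⁻¹ := by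
    rw [← Real.rpow_natCast, ← Real.rpow_mul hn'.le, ← Real.rpow_neg_one]
    norm_num
  have hb : (l ^ (7 / 2 : ℝ)) ^ 2 = l ^ 7 := by
    rw [← Real.rpow_natCast, ← Real.rpow_mul hl, ← Real.rpow_natCast]
    norm_num
  have hl7 : 0 ≤ l ^ 7 := by positivity
  rcases le_total p (1 / 2) with h | h
  · have : 1 / 4 ≤ (1 - p) ^ 2 := by nlinarith
    nlinarith
  · have hsq : (36 * (n : ℝ) ^ (-(1 / 2 : ℝ)) * l ^ (7 / 2 : ℝ)) ^ 2 ≤ (1 - p) ^ 2 :=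
      pow_le_pow_left₀ (by positivity) (by linarith) 2
    rw [mul_pow, mul_pow, ha, hb] at hsq
    have h2 : 36 ^ 2 * l ^ 7 ≤ n * (1 - p) ^ 2 := by
      calc 36 ^ 2 * l ^ 7 = n * (36 ^ 2 * (n : ℝ)⁻¹ * l ^ 7) := by field_simp
        _ ≤ _ := mul_le_mul_of_nonneg_left hsq hn'.le
    nlinarith

end Pseudorandom

open EDHC in
/-- Lemma 4.8: `G_{n,p}` is `p`-pseudorandom with probability at least `1 - 11/log n`. -/
theorem stmt_8 :
    ∃ N : ℕ, ∀ n : ℕ, N ≤ n → ∀ p : ℝ,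
      48 ^ 2 * (Real.log n) ^ 7 / n ≤ p →
      p ≤ 1 - 36 * (n : ℝ) ^ (-(1 / 2 : ℝ)) * (Real.log n) ^ (7 / 2 : ℝ) →
      gnpProb n p (fun G => ¬ IsPseudorandom n G p) ≤ 11 / Real.log n := by
  have hexp : Real.exp (-171380) ≤ 1 / 2 := by
    have := Real.add_one_le_exp (171380 : ℝ)
    rw [Real.exp_neg, inv_le_comm₀ (Real.exp_pos _) (by norm_num)]
    linarith
  obtain ⟨c, hc⟩ : ∃ c, c = 1 / 2 * Real.exp (-171380) := ⟨_, rfl⟩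
  have hc0 : 0 < c := by
    rw [hc]
    positivity
  have hlog : Filter.Tendsto (fun n : ℕ => Real.log n) Filter.atTop Filter.atTop :=
    Real.tendsto_log_atTop.comp tendsto_natCast_atTop_atTop
  obtain ⟨N, hN⟩ := Filter.eventually_atTop.1 ((hlog.eventually
    (eventually_pseudorandom_error_le hc0 (by linarith))).and
    ((hlog.eventually (Filter.eventually_ge_atTop 4)).and (Filter.eventually_gt_atTop 0)))
  refine ⟨N, fun n hn p hp hp' => ?_⟩
  obtain ⟨herr, hl, hn0⟩ := hN n hn
  have hn' : (0 : ℝ) < n := by exact_mod_cast hn0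
  have hl0 : 0 < Real.log n := by linarith
  refine (gnpProb_not_isPseudorandom_le (lt_of_lt_of_le (by positivity) hp)
    (lt_of_le_of_lt hp' (sub_lt_self _ (by positivity))) hl
    (le_mul_one_sub_sq hn0 hl0.le hp hp') hc0.le hc.le).trans herr
end

section
/- There exists N such that the following holds for all n ≥ N. Let G be an (r_G/n)-pseudorandom graph on n vertices with r_G ≥ log n, let r_H ≥ (549/550)·r_G, and let H be a spanning subgraph of G with δ(H) = r_H. Let W be a set of vertices of G with δ(H[W]) ≥ r_H/3, where H[W] is the subgraph of H induced by W. Then for every nonempty B ⊆ W, the number of connected components of H[W \ B] is at most |B|; moreover, H[W] is connected. -/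
open scoped Classical
open SimpleGraph

namespace EDHC

section AdjCount

variable {V : Type}

/-- The number of ordered pairs in `S × T` that are adjacent in `G`. -/
noncomputable def adjCount (G : SimpleGraph V) (S T : Finset V) : ℝ :=
  ∑ a ∈ S, ∑ b ∈ T, if G.Adj a b then 1 else 0

lemma adjCount_nonneg (G : SimpleGraph V) (S T : Finset V) : 0 ≤ adjCount G S T :=
  Finset.sum_nonneg fun _ _ => Finset.sum_nonneg fun _ _ => by split_ifs <;> simp

lemma adjCount_comm (G : SimpleGraph V) (S T : Finset V) : adjCount G S T = adjCount G T S := by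
  unfold adjCount
  rw [Finset.sum_comm]
  simp only [G.adj_comm]

lemma adjCount_union_right (G : SimpleGraph V) (R : Finset V) {S T : Finset V}
    (h : Disjoint S T) : adjCount G R (S ∪ T) = adjCount G R S + adjCount G R T := by
  unfold adjCount
  rw [← Finset.sum_add_distrib]
  exact Finset.sum_congr rfl fun _ _ => Finset.sum_union h

lemma adjCount_union_self (G : SimpleGraph V) {S T : Finset V} (h : Disjoint S T) :
    adjCount G (S ∪ T) (S ∪ T) = adjCount G S S + 2 * adjCount G S T + adjCount G T T := by
  rw [adjCount_union_right G _ h, adjCount_comm G _ S, adjCount_comm G _ T,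
    adjCount_union_right G _ h, adjCount_union_right G _ h, adjCount_comm G T S]
  ring

lemma adjCount_mono_right (G : SimpleGraph V) (R : Finset V) {S T : Finset V} (h : S ⊆ T) :
    adjCount G R S ≤ adjCount G R T :=
  Finset.sum_le_sum fun _ _ => Finset.sum_le_sum_of_subset_of_nonneg h
    fun _ _ _ => by split_ifs <;> simp

lemma adjCount_eq_add_sdiff {G H : SimpleGraph V} (h : H ≤ G) (S T : Finset V) :
    adjCount G S T = adjCount H S T + adjCount (G \ H) S T := by
  unfold adjCount
  simp only [← Finset.sum_add_distrib]
  refine Finset.sum_congr rfl fun a _ => Finset.sum_congr rfl fun b _ => ?_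
  by_cases h1 : H.Adj a b
  · simp [h1, h h1]
  · simp [h1]

lemma adjCount_eq_zero {G : SimpleGraph V} {S T : Finset V}
    (h : ∀ a ∈ S, ∀ b ∈ T, ¬ G.Adj a b) : adjCount G S T = 0 :=
  Finset.sum_eq_zero fun a ha => Finset.sum_eq_zero fun b hb => by simp [h a ha b hb]

lemma le_adjCount {G : SimpleGraph V} {S T : Finset V} {d : ℝ}
    (h : ∀ a ∈ S, d ≤ (T.filter (G.Adj a)).card) : S.card * d ≤ adjCount G S T := by
  unfold adjCount
  rw [← nsmul_eq_mul]
  refine Finset.card_nsmul_le_sum _ _ _ fun a ha => ?_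
  simpa using h a ha

/-- The minimum degree bounds each degree from below. -/
lemma minDeg_le_deg (G : SimpleGraph V) (v : V) : minDeg G ≤ deg G v :=
  Nat.sInf_le ⟨v, rfl⟩

variable [Fintype V]

lemma minDeg_mono [Nonempty V] {G H : SimpleGraph V} (h : H ≤ G) : minDeg H ≤ minDeg G := by
  obtain ⟨v, hv⟩ := Nat.sInf_mem (Set.range_nonempty (deg G))
  calc minDeg H ≤ deg H v := minDeg_le_deg H v
    _ ≤ deg G v := Set.ncard_le_ncard (fun _ hw => h hw) (Set.toFinite _)
    _ = minDeg G := hv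

lemma adjCount_self_eq_two_mul_eIn (G : SimpleGraph V) (S : Finset V) :
    adjCount G S S = 2 * eIn G (S : Set V) := by
  let K : SimpleGraph V :=
    { Adj := fun a b => G.Adj a b ∧ a ∈ S ∧ b ∈ S
      symm := ⟨fun a b h => ⟨h.1.symm, h.2.2, h.2.1⟩⟩
      loopless := ⟨fun a h => h.1.ne rfl⟩ }
  have hE : {e ∈ G.edgeSet | ∀ v ∈ e, v ∈ (S : Set V)} = K.edgeSet := by
    ext e
    induction e with
    | _ a b => simp [K]
  have h1 : eIn G (S : Set V) = K.edgeFinset.card := by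
    unfold eIn
    rw [hE, ← SimpleGraph.coe_edgeFinset, Set.ncard_coe_finset]
  have h2 := K.sum_degrees_eq_twice_card_edges
  rw [h1]
  have h3 : ((∑ v, K.degree v : ℕ) : ℝ) = 2 * K.edgeFinset.card := by exact_mod_cast h2
  rw [← h3]
  push_cast
  unfold adjCount
  rw [← Finset.sum_subset (Finset.subset_univ S)]
  · refine Finset.sum_congr rfl fun a ha => ?_
    rw [Finset.sum_boole, ← SimpleGraph.card_neighborFinset_eq_degree]
    congr 2
    ext b
    simp [K, ha, and_comm]
  · intro a _ ha
    have : K.neighborFinset a = ∅ := by ext b; simp [K, ha]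
    rw [← SimpleGraph.card_neighborFinset_eq_degree, this]
    simp

end AdjCount

section Jumbled

variable {V : Type} [Fintype V] {G H : SimpleGraph V} {p β : ℝ}

lemma IsJumbled.abs_adjCount_self_le (hG : IsJumbled G p β) (S : Finset V) :
    |adjCount G S S - p * (S.card * (S.card - 1))| ≤ 2 * β * S.card := by
  have h := hG (S : Set V)
  rw [Set.ncard_coe_finset, abs_le] at h
  rw [adjCount_self_eq_two_mul_eIn, abs_le]
  constructor <;> linarith [h.1, h.2]

lemma IsJumbled.abs_adjCount_le (hG : IsJumbled G p β) {S T : Finset V} (h : Disjoint S T) :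
    |adjCount G S T - p * (S.card * T.card)| ≤ 2 * β * (S.card + T.card) := by
  have h1 := abs_le.1 (hG.abs_adjCount_self_le S)
  have h2 := abs_le.1 (hG.abs_adjCount_self_le T)
  have h3 := abs_le.1 (hG.abs_adjCount_self_le (S ∪ T))
  rw [adjCount_union_self G h, Finset.card_union_of_disjoint h] at h3
  push_cast at h3
  rw [abs_le]
  constructor <;> nlinarith

/-- Two disjoint sets with no edges of `H` between them cannot both be large, when `H` has almost
as many edges as `G`. -/
lemma IsJumbled.mul_card_le (hG : IsJumbled G p β) (hHG : H ≤ G) (hp : 0 ≤ p) {d : ℝ}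
    (hβ : 0 ≤ β) (hd : d ≤ minDeg H) {S T : Finset V} (h : Disjoint S T)
    (hST : ∀ a ∈ S, ∀ b ∈ T, ¬ H.Adj a b) :
    2 * p * (S.card * T.card) ≤
      (p * Fintype.card V - d + 6 * β) * Fintype.card V := by
  have h1 := (abs_le.1 (hG.abs_adjCount_le h)).1
  have h2 := (abs_le.1 (hG.abs_adjCount_self_le Finset.univ)).2
  have h3 : (Finset.univ : Finset V).card * d ≤ adjCount H Finset.univ Finset.univ := by
    refine le_adjCount fun a _ => hd.trans ?_
    have := minDeg_le_deg H a
    rw [deg, ← SimpleGraph.coe_neighborFinset, Set.ncard_coe_finset,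
      SimpleGraph.neighborFinset_eq_filter] at this
    exact_mod_cast this
  rw [adjCount_eq_add_sdiff hHG] at h1 h2
  rw [adjCount_eq_zero hST] at h1
  have h4 : adjCount (G \ H) (S ∪ T) (S ∪ T) ≤ adjCount (G \ H) Finset.univ Finset.univ := by
    refine (adjCount_mono_right _ _ (Finset.subset_univ _)).trans ?_
    rw [adjCount_comm]
    exact adjCount_mono_right _ _ (Finset.subset_univ _)
  rw [adjCount_union_self _ h] at h4
  have h5 := adjCount_nonneg (G \ H) S S
  have h6 := adjCount_nonneg (G \ H) T T
  have h7 : (S.card + T.card : ℝ) ≤ Fintype.card V := by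
    rw [← Nat.cast_add, ← Finset.card_union_of_disjoint h]
    exact_mod_cast Finset.card_le_univ _
  have h8 := mul_le_mul_of_nonneg_left h7 hβ
  rw [Finset.card_univ] at h2 h3
  have h9 : 0 ≤ p * Fintype.card V := by positivity
  nlinarith

/-- If every vertex of `S` sends at least `d` edges to `S ∪ B`, then `S ∪ B` is large. -/
lemma IsJumbled.le_card_add_card (hG : IsJumbled G p β) (hHG : H ≤ G) (hp : 0 ≤ p) (hβ : 0 ≤ β)
    {d : ℝ} {S B : Finset V} (h : Disjoint S B) (hS : S.Nonempty) (hBS : B.card ≤ S.card)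
    (hd : ∀ a ∈ S, d ≤ ((S ∪ B).filter (H.Adj a)).card) :
    d ≤ p * (S.card + B.card) + 6 * β := by
  have h1 := (abs_le.1 (hG.abs_adjCount_le h)).2
  have h2 := (abs_le.1 (hG.abs_adjCount_self_le S)).2
  have h3 := le_adjCount hd
  have h4 := adjCount_eq_add_sdiff hHG S (S ∪ B)
  have h5 := adjCount_nonneg (G \ H) S (S ∪ B)
  rw [adjCount_union_right G _ h] at h4
  have hs : (0 : ℝ) < S.card := by exact_mod_cast hS.card_pos
  have hb : (B.card : ℝ) ≤ S.card := by exact_mod_cast hBS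
  have h6 := mul_le_mul_of_nonneg_left hb hβ
  have h7 : 0 ≤ p * S.card := by positivity
  refine le_of_mul_le_mul_left ?_ hs
  nlinarith

end Jumbled

/-- Weights bounded by `l` can be split into two almost equal halves. -/
lemma exists_sum_near_half {ι : Type*} [Fintype ι] (w : ι → ℕ) (l : ℕ) (hw : ∀ i, w i ≤ l)
    (h0 : 0 < ∑ i, w i) :
    ∃ P : Finset ι, 2 * ∑ i ∈ P, w i ≤ ∑ i, w i ∧ ∑ i, w i < 2 * (∑ i ∈ P, w i + l) := by
  obtain ⟨P, hP, hmax⟩ := Finset.exists_max_image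
    (Finset.univ.filter fun P : Finset ι => 2 * ∑ i ∈ P, w i ≤ ∑ i, w i) Finset.card
    ⟨∅, by simp⟩
  simp only [Finset.mem_filter, Finset.mem_univ, true_and] at hP hmax
  refine ⟨P, hP, ?_⟩
  have hne : P ≠ Finset.univ := by
    rintro rfl
    omega
  obtain ⟨i, hi⟩ : ∃ i, i ∉ P := by
    by_contra! hall
    exact hne (Finset.eq_univ_iff_forall.2 hall)
  by_contra! hle
  have := hmax (insert i P) (by
    rw [Finset.sum_insert hi]
    have := hw i
    omega)
  rw [Finset.card_insert_of_notMem hi] at this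
  omega

section Components

variable {V : Type} [Fintype V]

/-- The vertices of `U` lying in a component of `H.induce U` that belongs to `P`. -/
noncomputable def compUnion (H : SimpleGraph V) (U : Set V)
    (P : Finset (H.induce U).ConnectedComponent) : Finset V :=
  (Finset.univ.filter fun v : U => (H.induce U).connectedComponentMk v ∈ P).map
    (Function.Embedding.subtype _)

variable {H : SimpleGraph V} {U : Set V} {P Q : Finset (H.induce U).ConnectedComponent}

lemma mem_compUnion {v : V} : v ∈ compUnion H U P ↔
    ∃ h : v ∈ U, (H.induce U).connectedComponentMk ⟨v, h⟩ ∈ P := by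
  simp [compUnion]

lemma card_compUnion :
    (compUnion H U P).card = ∑ c ∈ P, (compUnion H U {c}).card := by
  simp only [compUnion, Finset.card_map, Finset.mem_singleton]
  rw [Finset.card_eq_sum_card_fiberwise (f := (H.induce U).connectedComponentMk) (t := P)
    (fun v hv => by simpa using hv)]
  refine Finset.sum_congr rfl fun c hc => ?_
  rw [Finset.filter_filter]
  congr 1
  ext v
  simp only [Finset.mem_filter, Finset.mem_univ, true_and, and_iff_right_iff_imp]
  rintro rfl
  exact hc

lemma card_compUnion_add_compl :
    (compUnion H U P).card + (compUnion H U Pᶜ).card = ∑ c, (compUnion H U {c}).card := by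
  rw [card_compUnion, card_compUnion (P := Pᶜ), Finset.sum_add_sum_compl]

lemma card_le_card_compUnion : P.card ≤ (compUnion H U P).card := by
  rw [card_compUnion, Finset.card_eq_sum_ones]
  refine Finset.sum_le_sum fun c _ => Finset.card_pos.2 ?_
  induction c using SimpleGraph.ConnectedComponent.ind with
  | _ v => exact ⟨v, mem_compUnion.2 ⟨v.2, by simp⟩⟩

lemma disjoint_compUnion (h : Disjoint P Q) : Disjoint (compUnion H U P) (compUnion H U Q) := by
  rw [Finset.disjoint_left] at h ⊢
  intro v hv hv'
  obtain ⟨_, hv⟩ := mem_compUnion.1 hv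
  obtain ⟨_, hv'⟩ := mem_compUnion.1 hv'
  exact h hv hv'

lemma mem_compUnion_of_adj {a b : V} (ha : a ∈ compUnion H U P) (hb : b ∈ U) (hab : H.Adj a b) :
    b ∈ compUnion H U P := by
  obtain ⟨haU, ha⟩ := mem_compUnion.1 ha
  refine mem_compUnion.2 ⟨hb, ?_⟩
  have hadj : (H.induce U).Adj ⟨a, haU⟩ ⟨b, hb⟩ := hab
  rwa [← SimpleGraph.ConnectedComponent.connectedComponentMk_eq_of_adj hadj]

lemma not_adj_compUnion (h : Disjoint P Q) :
    ∀ a ∈ compUnion H U P, ∀ b ∈ compUnion H U Q, ¬ H.Adj a b := fun _ ha _ hb hab =>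
  Finset.disjoint_left.1 (disjoint_compUnion h)
    (mem_compUnion_of_adj ha (mem_compUnion.1 hb).1 hab) hb

end Components

/-- If sets with no edges between them cannot both be large, and sets with small neighbourhood
in `W` are large, then deleting `B` from `W` leaves one component or at most `|B|` of them. -/
lemma card_components_le {V : Type} [Fintype V] [Nonempty V] {H : SimpleGraph V} {W : Set V}
    (hsparse : ∀ S T : Finset V, Disjoint S T → (∀ a ∈ S, ∀ b ∈ T, ¬ H.Adj a b) →
      1000 * ((S.card : ℝ) * T.card) ≤ (Fintype.card V : ℝ) ^ 2)
    (hexpand : ∀ S B : Finset V, Disjoint S B → S.Nonempty → (S : Set V) ⊆ W → B.card ≤ S.card →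
      (∀ a ∈ S, ∀ b ∈ W, H.Adj a b → b ∈ S ∪ B) →
      332 / 1000 * (Fintype.card V : ℝ) ≤ S.card + B.card)
    (B : Set V) (hcard : 1 < Nat.card (H.induce (W \ B)).ConnectedComponent) :
    Nat.card (H.induce (W \ B)).ConnectedComponent ≤ B.ncard := by
  by_contra! hB
  have hWB : ∀ v, v ∈ W \ B ↔ v ∈ W ∧ v ∉ B := fun v => Set.mem_sdiff v
  generalize W \ B = U at hcard hB hWB
  rw [Nat.card_eq_fintype_card] at hcard hB
  have hne : Nonempty (H.induce U).ConnectedComponent := Fintype.card_pos_iff.1 (by omega)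
  obtain ⟨c, -, hc⟩ := Finset.exists_max_image Finset.univ
    (fun c => (compUnion H U {c}).card) Finset.univ_nonempty
  have hcompl : ({c}ᶜ : Finset _).card + 1 = Fintype.card (H.induce U).ConnectedComponent := by
    rw [Finset.card_compl, Finset.card_singleton]
    omega
  have hle := card_le_card_compUnion (P := ({c}ᶜ : Finset (H.induce U).ConnectedComponent))
  have hBf : B.toFinset.card = B.ncard := by rw [Set.ncard_eq_toFinset_card']
  have hs := hexpand (compUnion H U {c}ᶜ) B.toFinset
    (Finset.disjoint_left.2 fun v hv hvB => ((hWB v).1 (mem_compUnion.1 hv).1).2 (by simpa using hvB))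
    (Finset.card_pos.1 (by omega)) (fun v hv => ((hWB v).1 (mem_compUnion.1 hv).1).1) (by omega)
    (fun a ha b hb hab => by
      by_cases hbB : b ∈ B
      · simp [hbB]
      · exact Finset.mem_union_left _ (mem_compUnion_of_adj ha ((hWB b).2 ⟨hb, hbB⟩) hab))
  have hl := hsparse _ _ (disjoint_compUnion disjoint_compl_right)
    (not_adj_compUnion (H := H) (P := {c}) disjoint_compl_right)
  have htot := card_compUnion_add_compl (H := H) (U := U) (P := {c})
  obtain ⟨P, hP, hP'⟩ := exists_sum_near_half (fun d => (compUnion H U {d}).card)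
    (compUnion H U {c}).card (fun d => hc d (Finset.mem_univ d)) (by omega)
  have hx := hsparse _ _ (disjoint_compUnion disjoint_compl_right)
    (not_adj_compUnion (H := H) (P := P) disjoint_compl_right)
  have htot' := card_compUnion_add_compl (H := H) (U := U) (P := P)
  rw [← card_compUnion (P := P)] at hP hP'
  have hBs : B.toFinset.card ≤ (compUnion H U {c}ᶜ).card := by omega
  have hpos : (0 : ℝ) < Fintype.card V := by exact_mod_cast Fintype.card_pos
  rw [← htot] at hP hP' htot'
  rify at hP hP' htot' hBs
  set n : ℝ := ((Fintype.card V : ℕ) : ℝ)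
  set s : ℝ := (((compUnion H U {c}ᶜ).card : ℕ) : ℝ)
  set l : ℝ := (((compUnion H U {c}).card : ℕ) : ℝ)
  set x : ℝ := (((compUnion H U P).card : ℕ) : ℝ)
  set y : ℝ := (((compUnion H U Pᶜ).card : ℕ) : ℝ)
  have hl0 : 0 ≤ l := Nat.cast_nonneg _
  have hs' : 166 / 1000 * n ≤ s := by linarith
  have hl' : l ≤ 7 / 1000 * n := by
    have := mul_le_mul_of_nonneg_left hs' hl0
    by_contra! hlt
    nlinarith
  have hx' : 7 / 100 * n ≤ x := by linarith
  have hy' : 8 / 100 * n ≤ y := by linarith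
  have := mul_le_mul hx' hy' (by positivity) (by linarith)
  nlinarith

/-- Every vertex of `W` has at least `minDeg (H.induce W)` neighbours in any set containing its
neighbours in `W`. -/
lemma minDeg_induce_le_card_filter {V : Type} {H : SimpleGraph V} {W : Set V}
    {a : V} (ha : a ∈ W) {T : Finset V} (hT : ∀ b ∈ W, H.Adj a b → b ∈ T) :
    minDeg (H.induce W) ≤ (T.filter (H.Adj a)).card := by
  refine (minDeg_le_deg _ ⟨a, ha⟩).trans ?_
  rw [deg, ← Set.ncard_image_of_injective _ Subtype.val_injective, ← Set.ncard_coe_finset]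
  refine Set.ncard_le_ncard ?_ (Finset.finite_toSet _)
  rintro _ ⟨b, hb, rfl⟩
  have hab : H.Adj a b := hb
  simp [hab, hT b b.2 hab]

end EDHC

open EDHC in
/-- Lemma 5.3 (Components). -/
theorem stmt_9 :
    ∃ N : ℕ, ∀ n : ℕ, N ≤ n →
      ∀ (rG rH : ℝ) (G H : SimpleGraph (Fin n)) (W : Set (Fin n)),
      IsPseudorandom n G (rG / n) → Real.log n ≤ rG →
      549 / 550 * rG ≤ rH → H ≤ G → (minDeg H : ℝ) = rH →
      rH / 3 ≤ (minDeg (H.induce W) : ℝ) →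
      (∀ B : Set (Fin n), B ⊆ W → B.Nonempty →
        Nat.card (H.induce (W \ B)).ConnectedComponent ≤ B.ncard) ∧
      (H.induce W).Connected := by
  refine ⟨2, fun n hn rG rH G H W hG hlog hrH hHG hmin hW => ?_⟩
  have : Nonempty (Fin n) := ⟨⟨0, by omega⟩⟩
  have hn0 : (0 : ℝ) < n := by exact_mod_cast (by omega : 0 < n)
  have hr : 0 < rG := (Real.log_pos (by exact_mod_cast hn)).trans_le hlog
  have hnp : (n : ℝ) * (rG / n) = rG := by field_simp
  have hp : 0 < rG / n := by positivity
  obtain ⟨hjum, -, -, ⟨-, hdeg, -⟩, -⟩ := hG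
  set p := rG / n with hpdef
  rw [hnp] at hjum hdeg
  have hHGmin : (minDeg H : ℝ) ≤ minDeg G := by exact_mod_cast minDeg_mono hHG
  set β := 2 * Real.sqrt (rG * (1 - p)) with hβdef
  have hβ0 : 0 ≤ β := by positivity
  have hβ : 55000 * β ≤ rG := by linarith
  have hcomp := fun B => card_components_le (H := H) (W := W)
    (fun S T hST hadj => by
      have h := hjum.mul_card_le hHG hp.le hβ0 le_rfl hST hadj
      rw [Fintype.card_fin, mul_comm p, hnp, hmin] at h
      rw [Fintype.card_fin]
      have h1 : rG - rH + 6 * β ≤ 2 / 1000 * rG := by linarith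
      have h2 := h.trans (mul_le_mul_of_nonneg_right h1 hn0.le)
      refine le_of_mul_le_mul_left ?_ hp
      calc p * (1000 * ((S.card : ℝ) * T.card)) ≤ (n * p) * n := by rw [hnp]; linarith
        _ = p * (n : ℝ) ^ 2 := by ring)
    (fun S B hSB hS hSW hBS hadj => by
      have h := hjum.le_card_add_card hHG hp.le hβ0 hSB hS hBS (d := rH / 3) fun a ha =>
        hW.trans (by exact_mod_cast minDeg_induce_le_card_filter (hSW ha) (hadj a ha))
      rw [Fintype.card_fin]
      refine le_of_mul_le_mul_left ?_ hp
      calc p * (332 / 1000 * (n : ℝ)) = 332 / 1000 * (n * p) := by ring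
        _ ≤ p * (S.card + B.card) := by rw [hnp]; linarith) B
  have hWne : Nonempty W := by
    by_contra hempty
    rw [not_nonempty_iff] at hempty
    have : minDeg (H.induce W) = 0 := by simp [minDeg, Set.range_eq_empty]
    rw [this, Nat.cast_zero] at hW
    linarith
  refine ⟨fun B _ hB => ?_, ?_⟩
  · rcases le_or_gt (Nat.card (H.induce (W \ B)).ConnectedComponent) 1 with h | h
    · exact h.trans ((Set.ncard_pos).2 hB)
    · exact hcomp B h
  · have h := hcomp ∅
    rw [Set.sdiff_empty, Set.ncard_empty] at h
    have hle : Nat.card (H.induce W).ConnectedComponent ≤ 1 := by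
      by_contra! hlt
      have := h hlt
      omega
    have hsub := (Finite.card_le_one_iff_subsingleton).1 hle
    exact ⟨fun u v => SimpleGraph.ConnectedComponent.eq.1 (Subsingleton.elim _ _)⟩
end

section
/- There exists N such that the following holds for all n ≥ N. Let G be an (r_G/n)-pseudorandom graph on n vertices with r_G ≥ (log n)², and let G' be a graph on the same vertex set obtained from G by first deleting the edges of an arbitrary matching M and then adding an arbitrary set of additional edges. Let r be an even integer. For disjoint vertex sets S and T, let Q_r(S,T) be the number of connected components C of G' − (S ∪ T) such that r·|C| + e_{G'}(C,T) is odd. Then Q_r(S,T) ≤ |S| + |T| for all disjoint vertex sets S and T. -/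
open scoped Classical
open SimpleGraph

namespace EDHC

lemma sum_card_adj_eq_two_mul_eIn {V : Type} [Fintype V] (G : SimpleGraph V) (S : Finset V) :
    ∑ v ∈ S, (S.filter (G.Adj v)).card = 2 * eIn G S := by
  let K : SimpleGraph V :=
    { Adj := fun a b => G.Adj a b ∧ a ∈ S ∧ b ∈ S
      symm := ⟨fun a b h => ⟨h.1.symm, h.2.2, h.2.1⟩⟩
      loopless := ⟨fun a h => h.1.ne rfl⟩ }
  have hK : eIn G S = K.edgeFinset.card := by
    rw [eIn, ← Set.ncard_coe_finset, SimpleGraph.coe_edgeFinset]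
    congr 1
    ext e
    induction e with
    | _ a b => simp [K]
  have hdeg (v : V) : K.degree v = if v ∈ S then (S.filter (G.Adj v)).card else 0 := by
    rw [← SimpleGraph.card_neighborFinset_eq_degree]
    split_ifs with h
    · congr 1
      ext u
      simp [K, h, and_comm]
    · rw [Finset.card_eq_zero]
      ext u
      simp [K, h]
  rw [hK, ← K.sum_degrees_eq_twice_card_edges]
  simp [hdeg, Finset.sum_ite_mem]

lemma IsJumbled.sum_card_adj_le {V : Type} [Fintype V] {G : SimpleGraph V} {p β : ℝ}
    (h : IsJumbled G p β) (S : Finset V) :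
    (∑ v ∈ S, ((S.filter (G.Adj v)).card : ℝ)) ≤ (p * (S.card - 1) + 2 * β) * S.card := by
  have h₁ := (abs_le.1 (h S)).2
  have h₂ := congrArg (Nat.cast (R := ℝ)) (sum_card_adj_eq_two_mul_eIn G S)
  push_cast at h₂
  rw [Set.ncard_coe_finset] at h₁
  linarith

lemma IsJumbled.le_sum_card_adj {V : Type} [Fintype V] {G : SimpleGraph V} {p β : ℝ}
    (h : IsJumbled G p β) (S : Finset V) :
    (p * (S.card - 1) - 2 * β) * S.card ≤ ∑ v ∈ S, ((S.filter (G.Adj v)).card : ℝ) := by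
  have h₁ := (abs_le.1 (h S)).1
  have h₂ := congrArg (Nat.cast (R := ℝ)) (sum_card_adj_eq_two_mul_eIn G S)
  push_cast at h₂
  rw [Set.ncard_coe_finset] at h₁
  linarith

lemma card_filter_adj_le_of_matching {V : Type} [Fintype V] {G M : SimpleGraph V}
    (hM : ∀ v, (M.neighborSet v).ncard ≤ 1) {v : V} {X Y : Finset V}
    (h : ∀ u ∈ X, G.Adj v u → ¬ M.Adj v u → u ∈ Y) :
    (X.filter (G.Adj v)).card ≤ (Y.filter (G.Adj v)).card + 1 := by
  have hN : (M.neighborFinset v).card ≤ 1 := by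
    rw [← Set.ncard_coe_finset, SimpleGraph.coe_neighborFinset]
    exact hM v
  have hsub : X.filter (G.Adj v) ⊆ Y.filter (G.Adj v) ∪ M.neighborFinset v := by
    intro u hu
    simp only [Finset.mem_filter, Finset.mem_union, SimpleGraph.mem_neighborFinset] at hu ⊢
    by_cases hm : M.Adj v u
    · exact Or.inr hm
    · exact Or.inl ⟨h u hu.1 hu.2 hm, hu.2⟩
  have := (Finset.card_le_card hsub).trans (Finset.card_union_le _ _)
  omega

/-- In a jumbled graph, if deleting a matching splits `R` into parts of size at most `c`,
then `c` is almost the size of `R`. -/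
lemma IsJumbled.mul_card_sub_le {V ι : Type} [Fintype V] {G M : SimpleGraph V} {p β c : ℝ}
    (h : IsJumbled G p β) (hp : 0 ≤ p) (hM : ∀ v, (M.neighborSet v).ncard ≤ 1)
    {R : Finset V} (hR : R.Nonempty) (f : V → ι)
    (hf : ∀ u ∈ R, ∀ v ∈ R, G.Adj u v → ¬ M.Adj u v → f u = f v)
    (hc : ∀ i, ((R.filter (f · = i)).card : ℝ) ≤ c) :
    p * (R.card - c) ≤ 4 * β + 1 := by
  have hpart : ∑ v ∈ R, (((R.filter (f · = f v)).filter (G.Adj v)).card : ℝ)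
      ≤ (p * (c - 1) + 2 * β) * R.card := by
    rw [← Finset.sum_fiberwise_of_maps_to
      (t := R.image f) (g := f) (fun x hx => Finset.mem_image_of_mem f hx),
      Finset.card_eq_sum_card_image f R, Nat.cast_sum, Finset.mul_sum]
    refine Finset.sum_le_sum fun i _ => ?_
    calc _ = ∑ v ∈ R.filter (f · = i), (((R.filter (f · = i)).filter (G.Adj v)).card : ℝ) := by
          refine Finset.sum_congr rfl fun v hv => ?_
          rw [(Finset.mem_filter.1 hv).2]
      _ ≤ _ := h.sum_card_adj_le _
      _ ≤ _ := by
          have := hc i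
          gcongr
  have hsum : ∑ v ∈ R, ((R.filter (G.Adj v)).card : ℝ)
      ≤ ∑ v ∈ R, ((((R.filter (f · = f v)).filter (G.Adj v)).card : ℝ) + 1) := by
    refine Finset.sum_le_sum fun v hv => ?_
    exact_mod_cast card_filter_adj_le_of_matching hM
      fun u hu hvu hm => Finset.mem_filter.2 ⟨hu, (hf v hv u hu hvu hm).symm⟩
  have hlow := h.le_sum_card_adj R
  rw [Finset.sum_add_distrib, Finset.sum_const, nsmul_eq_mul, mul_one] at hsum
  have hpos : (0 : ℝ) < R.card := by exact_mod_cast hR.card_pos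
  have : (p * (R.card - 1) - 2 * β) * R.card ≤ (p * (c - 1) + 2 * β + 1) * R.card := by
    linarith
  have := le_of_mul_le_mul_right this hpos
  linarith

/-- A jumbled graph of large minimum degree remains tough after deleting a matching. -/
lemma IsJumbled.card_image_le {V ι : Type} [Fintype V] {G M : SimpleGraph V} {p β : ℝ}
    (h : IsJumbled G p β) (hp : 0 ≤ p) (hβ : 0 ≤ β)
    (hδ : 20 * β + 5 < minDeg G)
    (hM : ∀ v, (M.neighborSet v).ncard ≤ 1) {W : Finset V} (hW : W.Nonempty) (f : V → ι)
    (hf : ∀ u ∉ W, ∀ v ∉ W, G.Adj u v → ¬ M.Adj u v → f u = f v) :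
    (Wᶜ.image f).card ≤ W.card := by
  by_contra! hlt
  have hR : Wᶜ.Nonempty := by
    by_contra! hE
    simp [hE] at hlt
  obtain ⟨i, -, hi⟩ := Finset.exists_max_image (Wᶜ.image f)
    (fun i => (Wᶜ.filter (f · = i)).card) (hR.image f)
  set U := Wᶜ.filter (f · ≠ i)
  have hWU : W.card ≤ U.card := by
    have hsub : Wᶜ.image f ⊆ insert i (U.image f) := by
      intro j hj
      obtain ⟨v, hv, rfl⟩ := Finset.mem_image.1 hj
      by_cases hvi : f v = i
      · simp [hvi]
      · exact Finset.mem_insert_of_mem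
          (Finset.mem_image_of_mem f (Finset.mem_filter.2 ⟨hv, hvi⟩))
    have h₁ := Finset.card_le_card hsub
    have h₂ := Finset.card_insert_le i (U.image f)
    have h₃ : (U.image f).card ≤ U.card := Finset.card_image_le
    omega
  have hUpos : (0 : ℝ) < U.card := by exact_mod_cast hW.card_pos.trans_le hWU
  have hsplit : ((Wᶜ.filter (f · = i)).card : ℝ) + U.card = Wᶜ.card := by
    exact_mod_cast Finset.card_filter_add_card_filter_not (s := Wᶜ) (f · = i)
  have hsmall : p * U.card ≤ 4 * β + 1 := by
    have := h.mul_card_sub_le (c := (Wᶜ.filter (f · = i)).card) hp hM hR f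
      (fun u hu v hv => hf u (Finset.mem_compl.1 hu) v (Finset.mem_compl.1 hv)) fun j => by
        by_cases hj : j ∈ Wᶜ.image f
        · exact_mod_cast hi j hj
        · have hempty : Wᶜ.filter (f · = j) = ∅ := Finset.filter_eq_empty_iff.2
            fun v hv hvj => hj (hvj ▸ Finset.mem_image_of_mem f hv)
          rw [hempty]
          simp
    rwa [← hsplit, add_sub_cancel_left] at this
  have hdeg (v : V) (hv : v ∈ U) :
      (minDeg G : ℝ) - 1 ≤ (((U ∪ W).filter (G.Adj v)).card : ℝ) := by
    have hvW := Finset.mem_filter.1 hv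
    have h₁ : minDeg G ≤ (Finset.univ.filter (G.Adj v)).card := by
      refine (Nat.sInf_le (Set.mem_range_self v)).trans_eq ?_
      rw [deg, ← Set.ncard_coe_finset]
      congr 1
      ext u
      simp
    have h₂ := card_filter_adj_le_of_matching (G := G) hM (v := v) (X := Finset.univ)
      (Y := U ∪ W) fun u _ hvu hm => by
        by_cases hu : u ∈ W
        · exact Finset.mem_union_right _ hu
        · refine Finset.mem_union_left _ (Finset.mem_filter.2 ⟨Finset.mem_compl.2 hu, ?_⟩)
          exact hf v (Finset.mem_compl.1 hvW.1) u hu hvu hm ▸ hvW.2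
    rw [sub_le_iff_le_add]
    exact_mod_cast h₁.trans h₂
  have hlow : (U.card : ℝ) * (minDeg G - 1) ≤
      ∑ v ∈ U ∪ W, (((U ∪ W).filter (G.Adj v)).card : ℝ) := by
    rw [← nsmul_eq_mul]
    exact (Finset.card_nsmul_le_sum _ _ _ hdeg).trans
      (Finset.sum_le_sum_of_subset_of_nonneg Finset.subset_union_left fun _ _ _ => by positivity)
  have hup := h.sum_card_adj_le (U ∪ W)
  have hY : ((U ∪ W).card : ℝ) ≤ 2 * U.card := by
    have := Finset.card_union_le U W
    exact_mod_cast (by omega : (U ∪ W).card ≤ 2 * U.card)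
  have hup' : (p * ((U ∪ W).card - 1) + 2 * β) * (U ∪ W).card ≤
      (p * (2 * U.card) + 2 * β) * (2 * U.card) := by
    gcongr
    linarith
  have : (U.card : ℝ) * (minDeg G - 1) ≤ U.card * (4 * (p * U.card) + 4 * β) := by
    linarith
  have := le_of_mul_le_mul_left this hUpos
  linarith

lemma IsJumbled.mono {V : Type} {G : SimpleGraph V} {p β β' : ℝ} (h : IsJumbled G p β)
    (hβ : β ≤ β') : IsJumbled G p β' := fun S =>
  (h S).trans (by gcongr)

lemma forty_mul_sqrt_add_five_lt {x L : ℝ} (hL : 100 ≤ L) (hx : L ^ 2 ≤ x) :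
    40 * √x + 5 < x - 2 * √(x * L) := by
  have hs : L ≤ √x := Real.le_sqrt_of_sq_le hx
  have hx0 : 0 ≤ x := (sq_nonneg L).trans hx
  have hsx : √x ^ 2 = x := Real.sq_sqrt hx0
  have hsL : √L ≤ √x / 10 := by
    rw [Real.sqrt_le_left (by linarith)]
    nlinarith
  rw [Real.sqrt_mul hx0]
  have := mul_le_mul_of_nonneg_left hsL (Real.sqrt_nonneg x)
  nlinarith

/-- The number of components of `K - W` is at most the number of fibres of the
component map over the complement of `W`. -/
lemma card_connectedComponent_induce_compl_le {V : Type} [Fintype V] {K : SimpleGraph V}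
    (W : Finset V) (A : Set V) (hA : A = W)
    (H : ∀ (f : V → Option (K.induce Aᶜ).ConnectedComponent),
      (∀ u ∉ W, ∀ v ∉ W, K.Adj u v → f u = f v) → (Wᶜ.image f).card ≤ W.card) :
    Nat.card (K.induce Aᶜ).ConnectedComponent ≤ W.card := by
  subst hA
  let f : V → Option (K.induce (W : Set V)ᶜ).ConnectedComponent := fun v =>
    if hv : v ∈ (W : Set V)ᶜ then
      some ((K.induce (W : Set V)ᶜ).connectedComponentMk ⟨v, hv⟩) else none
  have hfv (v : V) (hv : v ∈ (W : Set V)ᶜ) :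
      f v = some ((K.induce (W : Set V)ᶜ).connectedComponentMk ⟨v, hv⟩) := dif_pos hv
  refine le_trans ?_ (H f fun u hu v hv huv => ?_)
  · rw [← Fintype.card_coe, ← Nat.card_eq_fintype_card]
    have hmem (c : (K.induce (W : Set V)ᶜ).ConnectedComponent) : some c ∈ Wᶜ.image f := by
      induction c using SimpleGraph.ConnectedComponent.ind with
      | h v =>
        exact Finset.mem_image.2 ⟨v, Finset.mem_compl.2 v.2, hfv v v.2⟩
    exact Nat.card_le_card_of_injective (fun c => ⟨some c, hmem c⟩) fun c d hcd => by
      simpa using hcd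
  · rw [hfv u (by simpa using hu), hfv v (by simpa using hv), Option.some_inj,
      SimpleGraph.ConnectedComponent.eq]
    exact SimpleGraph.Adj.reachable (by simpa using huv)

end EDHC

open EDHC in
/-- Corollary 5.4 (Qrst). -/
theorem stmt_10 :
    ∃ N : ℕ, ∀ n : ℕ, N ≤ n →
      ∀ (rG : ℝ) (G M G' : SimpleGraph (Fin n)) (r : ℕ),
      IsPseudorandom n G (rG / n) → (Real.log n) ^ 2 ≤ rG →
      (∀ v, (M.neighborSet v).ncard ≤ 1) → G \ M ≤ G' → Even r →
      ∀ S T : Set (Fin n), Disjoint S T →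
        Nat.card {c : (G'.induce ((S ∪ T)ᶜ)).ConnectedComponent //
            Odd (r * Nat.card c.supp + eBtw G' (Subtype.val '' c.supp) T)}
          ≤ S.ncard + T.ncard := by
  refine ⟨⌈Real.exp 100⌉₊, fun n hn rG G M G' r hG hrG hM hG' hr S T hST => ?_⟩
  rcases (S ∪ T).eq_empty_or_nonempty with hE | hne
  · obtain ⟨rfl, rfl⟩ := Set.union_empty_iff.1 hE
    have hodd (c : (G'.induce ((∅ ∪ ∅ : Set (Fin n))ᶜ)).ConnectedComponent) :
        ¬ Odd (r * Nat.card c.supp + eBtw G' (Subtype.val '' c.supp) ∅) := by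
      simpa [eBtw, Nat.not_odd_iff_even] using hr.mul_right _
    have : IsEmpty {c : (G'.induce ((∅ ∪ ∅ : Set (Fin n))ᶜ)).ConnectedComponent //
        Odd (r * Nat.card c.supp + eBtw G' (Subtype.val '' c.supp) ∅)} :=
      ⟨fun c => hodd c.1 c.2⟩
    exact Nat.card_of_isEmpty.le.trans (Nat.zero_le _)
  · have hnexp : Real.exp 100 ≤ n := Nat.ceil_le.1 hn
    have hn0 : (0 : ℝ) < n := (Real.exp_pos _).trans_le hnexp
    have hL : 100 ≤ Real.log n := (Real.le_log_iff_exp_le hn0).2 hnexp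
    have hr0 : 0 ≤ rG := (sq_nonneg _).trans hrG
    have hp : 0 ≤ rG / n := by positivity
    obtain ⟨hJ, -, -, ⟨hδ, -, -⟩, -⟩ := hG
    rw [mul_div_cancel₀ _ hn0.ne'] at hJ hδ
    have hJ' : IsJumbled G (rG / n) (2 * √rG) := hJ.mono (by
      gcongr
      nlinarith [mul_nonneg hr0 hp])
    have hδ' := forty_mul_sqrt_add_five_lt hL hrG
    rw [← Set.ncard_union_eq hST, Set.ncard_eq_toFinset_card']
    refine (Nat.card_le_card_of_injective _ Subtype.val_injective).trans
      (card_connectedComponent_induce_compl_le _ _ (by simp) fun f hf => ?_)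
    have hδ'' : 20 * (2 * √rG) + 5 < minDeg G := by linarith
    convert hJ'.card_image_le hp (by positivity) hδ'' hM (by simpa using hne) f
      fun u hu v hv huv hm => hf u hu v hv (hG' ⟨huv, hm⟩)
end
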